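/- Let x ∈ S_n be a maximal singular point (MSP) for w ∈ S_n with Δ(x,w) = {1,…,n}, and suppose x consists of exactly three decreasing sequences, i.e. x = [k,…,1, k+l,…,k+1, k+l+m,…,k+l+1] in one-line notation for some k,l,m ≥ 1 with k + l + m = n. Then: (1) l ≥ 2; (2) if k > 1 or m > 1 then l = 2; and (3) w = [k+l, k,…,2, k+l+m, k+l−1,…,k+2, 1, k+l+m−1,…,k+l+1, k+1]. -/

import Mathlib

open scoped Classical

namespace BSW

/-- The number of inversions (the length) of a permutation of `Fin n`. -/
def invLen {n : ℕ} (w : Equiv.Perm (Fin n)) : ℕ :=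
  (Finset.univ.filter (fun p : Fin n × Fin n => p.1 < p.2 ∧ w p.2 < w p.1)).card

/-- The rank function `r_w(p,q) = #{i : 1 ≤ i ≤ p and w(i) ≥ q}`, where the
permutation of `Fin n` is regarded as a permutation of `{1,…,n}` (so position
`i : Fin n` corresponds to `i+1` and value `w i` to `(w i)+1`). -/
def rank {n : ℕ} (w : Equiv.Perm (Fin n)) (p q : ℤ) : ℕ :=
  (Finset.univ.filter (fun i : Fin n =>
    ((i : ℕ) : ℤ) + 1 ≤ p ∧ q ≤ ((w i : ℕ) : ℤ) + 1)).card

/-- The difference function `d_{x,w}(p,q) = r_w(p,q) − r_x(p,q)`. -/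
def dxw {n : ℕ} (x w : Equiv.Perm (Fin n)) (p q : ℤ) : ℤ :=
  (rank w p q : ℤ) - (rank x p q : ℤ)

/-- The Bruhat order: `x ≤ w` iff `d_{x,w}` is everywhere non-negative. -/
def bruhatLE {n : ℕ} (x w : Equiv.Perm (Fin n)) : Prop :=
  ∀ p q : ℤ, 0 ≤ dxw x w p q

/-- The set of transpositions in `S_n`. -/
def transpositions (n : ℕ) : Set (Equiv.Perm (Fin n)) :=
  {t | ∃ a b : Fin n, a ≠ b ∧ t = Equiv.swap a b}

/-- `R(x,w) = {t ∈ T : l(xt) > l(x) and xt ≤ w}`. -/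
def R {n : ℕ} (x w : Equiv.Perm (Fin n)) : Set (Equiv.Perm (Fin n)) :=
  {t | t ∈ transpositions n ∧ invLen x < invLen (x * t) ∧ bruhatLE (x * t) w}

/-- `x` is a maximal singular point (MSP) for `w`. -/
def MSP {n : ℕ} (x w : Equiv.Perm (Fin n)) : Prop :=
  bruhatLE x w ∧ ((invLen w : ℤ) - (invLen x : ℤ) < ((R x w).ncard : ℤ)) ∧
    ∀ t ∈ R x w, ((R (x * t) w).ncard : ℤ) = (invLen w : ℤ) - (invLen (x * t) : ℤ)

/-- `Δ(x,w) = {i : t_{{i,j}} ∈ R(x,w) for some j}`. -/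
def Delta {n : ℕ} (x w : Equiv.Perm (Fin n)) : Set (Fin n) :=
  {i | ∃ j : Fin n, Equiv.swap i j ∈ R x w}

/-- `Δ(x,w)` as a finset. -/
noncomputable def DeltaFinset {n : ℕ} (x w : Equiv.Perm (Fin n)) : Finset (Fin n) :=
  (Set.toFinite (Delta x w)).toFinset

/-- `σ ∈ S_k` is the flattening of `x` along the increasing enumeration `d_1 < … < d_k`
of a set `D` of positions with `#D = k`: the unique permutation of `{1,…,k}` with
`σ(a) < σ(b)` iff `x(d_a) < x(d_b)`. -/
def IsFlatteningOn {n k : ℕ} (x : Equiv.Perm (Fin n)) (D : Finset (Fin n))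
    (hD : D.card = k) (σ : Equiv.Perm (Fin k)) : Prop :=
  ∀ a b : Fin k, σ a < σ b ↔ x ((D.orderIsoOfFin hD a : Fin n)) < x ((D.orderIsoOfFin hD b : Fin n))

/-- Values (0-indexed) of the permutation `x_{k,m} = [k,…,1, k+m,…,k+1]`. -/
def xkmVal (k m i : ℕ) : ℕ :=
  if i < k then k - 1 - i else 2 * k + m - 1 - i

/-- Values (0-indexed) of the permutation `w_{k,m} = [k+m, k,…,2, k+m−1,…,k+1, 1]`. -/
def wkmVal (k m i : ℕ) : ℕ :=
  if i = 0 then k + m - 1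
  else if i < k then k - i
  else if i < k + m - 1 then 2 * k + m - 2 - i
  else 0

/-- Values (0-indexed) of the permutation `x_{k,l,m} = [k,…,1, k+l,…,k+1, k+l+m,…,k+l+1]`. -/
def xklmVal (k l m i : ℕ) : ℕ :=
  if i < k then k - 1 - i
  else if i < k + l then 2 * k + l - 1 - i
  else 2 * (k + l) + m - 1 - i

/-- Values (0-indexed) of the permutation
`w_{k,l,m} = [k+l, k,…,2, k+l+m, k+l−1,…,k+2, 1, k+l+m−1,…,k+l+1, k+1]`. -/
def wklmVal (k l m i : ℕ) : ℕ :=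
  if i = 0 then k + l - 1
  else if i < k then k - i
  else if i = k then k + l + m - 1
  else if i < k + l - 1 then 2 * k + l - 1 - i
  else if i = k + l - 1 then 0
  else if i < k + l + m - 1 then 2 * (k + l) + m - 2 - i
  else k

/-- Natural-number version of `rank`, counting positions `< p` carrying values `≥ q`. -/
def rk {n : ℕ} (w : Equiv.Perm (Fin n)) (p q : ℕ) : ℕ :=
  (Finset.univ.filter (fun i : Fin n => (i : ℕ) < p ∧ q ≤ (w i : ℕ))).card

/-- Natural-number version of `dxw`. -/
def dd {n : ℕ} (y w : Equiv.Perm (Fin n)) (p q : ℕ) : ℤ := (rk w p q : ℤ) - (rk y p q : ℤ)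

lemma rank_eq_rk {n : ℕ} (w : Equiv.Perm (Fin n)) (p q : ℤ) :
    rank w p q = rk w p.toNat (q - 1).toNat := by
  unfold rank rk
  congr 1
  ext i
  simp only [Finset.mem_filter, Finset.mem_univ, true_and]
  omega

lemma bruhatLE_iff {n : ℕ} (y w : Equiv.Perm (Fin n)) :
    bruhatLE y w ↔ ∀ p q : ℕ, 0 ≤ dd y w p q := by
  constructor
  · intro h p q
    have := h p (q + 1)
    simpa [dxw, rank_eq_rk, dd] using this
  · intro h p q
    simpa [dxw, rank_eq_rk, dd] using h p.toNat (q - 1).toNat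

lemma rk_succ_left {n : ℕ} (w : Equiv.Perm (Fin n)) (p : Fin n) (q : ℕ) :
    rk w (p + 1) q = rk w p q + if q ≤ (w p : ℕ) then 1 else 0 := by
  unfold rk
  split_ifs with h
  · have : Finset.univ.filter (fun i : Fin n => (i : ℕ) < (p : ℕ) + 1 ∧ q ≤ (w i : ℕ))
        = insert p (Finset.univ.filter (fun i : Fin n => (i : ℕ) < p ∧ q ≤ (w i : ℕ))) := by
      ext i
      simp only [Finset.mem_filter, Finset.mem_univ, true_and, Finset.mem_insert]
      constructor
      · rintro ⟨h1, h2⟩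
        by_cases hi : i = p
        · exact Or.inl hi
        · exact Or.inr ⟨by have := Fin.val_ne_of_ne hi; omega, h2⟩
      · rintro (rfl | ⟨h1, h2⟩)
        · exact ⟨by omega, h⟩
        · exact ⟨by omega, h2⟩
    rw [this, Finset.card_insert_of_notMem (by simp)]
  · rw [add_zero]
    congr 1
    ext i
    simp only [Finset.mem_filter, Finset.mem_univ, true_and]
    constructor
    · rintro ⟨h1, h2⟩
      have : i ≠ p := by rintro rfl; exact h h2
      exact ⟨by have := Fin.val_ne_of_ne this; omega, h2⟩
    · rintro ⟨h1, h2⟩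
      exact ⟨by omega, h2⟩

lemma rk_zero_left {n : ℕ} (w : Equiv.Perm (Fin n)) (q : ℕ) : rk w 0 q = 0 := by
  simp [rk]

lemma rk_mul_swap {n : ℕ} (y : Equiv.Perm (Fin n)) {a b : Fin n} (hab : a < b)
    (hy : y a < y b) (p q : ℕ) :
    rk (y * Equiv.swap a b) p q = rk y p q +
      if (a : ℕ) < p ∧ p ≤ b ∧ (y a : ℕ) < q ∧ q ≤ y b then 1 else 0 := by
  have hab' : (a : ℕ) < b := hab
  have hy' : (y a : ℕ) < y b := hy
  by_cases hp : p ≤ n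
  swap
  · have key : ∀ z : Equiv.Perm (Fin n),
        rk z p q = (Finset.univ.filter (fun i : Fin n => q ≤ (i : ℕ))).card := by
      intro z
      unfold rk
      refine Finset.card_bij (fun i _ => z i) ?_ ?_ ?_
      · intro i hi; simpa using (Finset.mem_filter.1 hi).2.2
      · intro i _ j _ h; exact z.injective h
      · intro j hj
        refine ⟨z.symm j, ?_, by simp⟩
        have := (Finset.mem_filter.1 hj).2
        simp only [Finset.mem_filter, Finset.mem_univ, true_and, Equiv.apply_symm_apply]
        exact ⟨by omega, this⟩
    rw [key, key, if_neg (by omega)]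
    rfl
  induction p with
  | zero => simp [rk_zero_left]
  | succ p ih =>
    have h1 := rk_succ_left (y * Equiv.swap a b) ⟨p, hp⟩ q
    have h2 := rk_succ_left y ⟨p, hp⟩ q
    simp only at h1 h2
    rw [h1, h2, ih (by omega)]
    by_cases hpa : (⟨p, hp⟩ : Fin n) = a
    · have : p = a := by rw [← hpa]
      rw [hpa]
      simp only [Equiv.Perm.mul_apply, Equiv.swap_apply_left]
      split_ifs <;> omega
    · by_cases hpb : (⟨p, hp⟩ : Fin n) = b
      · have : p = b := by rw [← hpb]
        rw [hpb]
        simp only [Equiv.Perm.mul_apply, Equiv.swap_apply_right]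
        split_ifs <;> omega
      · have e1 : p ≠ a := fun h => hpa (Fin.ext h)
        have e2 : p ≠ b := fun h => hpb (Fin.ext h)
        simp only [Equiv.Perm.mul_apply, Equiv.swap_apply_of_ne_of_ne hpa hpb]
        split_ifs <;> omega

lemma dd_mul_swap {n : ℕ} (y w : Equiv.Perm (Fin n)) {a b : Fin n} (hab : a < b)
    (hy : y a < y b) (p q : ℕ) :
    dd (y * Equiv.swap a b) w p q = dd y w p q -
      if (a : ℕ) < p ∧ p ≤ b ∧ (y a : ℕ) < q ∧ q ≤ y b then 1 else 0 := by
  unfold dd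
  rw [rk_mul_swap y hab hy]
  split_ifs <;> push_cast <;> ring

/-- `d` is at least one on the half-open rectangle `(p₁,p₂] × (q₁,q₂]`. -/
def PosBox (d : ℕ → ℕ → ℤ) (p₁ p₂ q₁ q₂ : ℕ) : Prop :=
  ∀ p q, p₁ < p → p ≤ p₂ → q₁ < q → q ≤ q₂ → 1 ≤ d p q

/-- The transposition `t_{i,j}` goes up from `y` and stays below `w`. -/
def Up {n : ℕ} (y w : Equiv.Perm (Fin n)) (i j : Fin n) : Prop :=
  i < j ∧ y i < y j ∧ PosBox (dd y w) i j (y i) (y j)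

lemma bruhatLE_mul_swap_iff {n : ℕ} {y w : Equiv.Perm (Fin n)} (hyw : bruhatLE y w)
    {a b : Fin n} (hab : a < b) (hy : y a < y b) :
    bruhatLE (y * Equiv.swap a b) w ↔ PosBox (dd y w) a b (y a) (y b) := by
  rw [bruhatLE_iff] at hyw ⊢
  constructor
  · intro h p q h1 h2 h3 h4
    have := h p q
    rw [dd_mul_swap y w hab hy, if_pos ⟨h1, h2, h3, h4⟩] at this
    omega
  · intro h p q
    rw [dd_mul_swap y w hab hy]
    split_ifs with hc
    · have := h p q hc.1 hc.2.1 hc.2.2.1 hc.2.2.2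
      omega
    · have := hyw p q
      omega

section PairSums

variable {n : ℕ}

lemma sum_pairs_split (f : Fin n → Fin n → ℕ) (hs : ∀ i j, f i j = f j i)
    (hd : ∀ i, f i i = 0) {a b : Fin n} (hab : a ≠ b) :
    ∑ i, ∑ j, f i j = 2 * f a b
      + 2 * ∑ c ∈ (Finset.univ.erase a).erase b, (f a c + f b c)
      + ∑ c ∈ (Finset.univ.erase a).erase b, ∑ d ∈ (Finset.univ.erase a).erase b, f c d := by
  have key : ∀ g : Fin n → ℕ,
      ∑ i, g i = g a + (g b + ∑ c ∈ (Finset.univ.erase a).erase b, g c) := by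
    intro g
    rw [Finset.add_sum_erase (Finset.univ.erase a) g (by simp [hab.symm]),
      Finset.add_sum_erase Finset.univ g (Finset.mem_univ a)]
  rw [key (fun i => ∑ j, f i j)]
  simp only [key (f _)]
  have e1 : ∀ b, ∑ c ∈ (Finset.univ.erase a).erase b, f c a
      = ∑ c ∈ (Finset.univ.erase a).erase b, f a c := fun b =>
    Finset.sum_congr rfl fun c _ => hs c a
  have e2 : ∑ c ∈ (Finset.univ.erase a).erase b, f c b
      = ∑ c ∈ (Finset.univ.erase a).erase b, f b c :=
    Finset.sum_congr rfl fun c _ => hs c b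
  simp only [Finset.sum_add_distrib, hd, hs b a, e1, e2]
  ring

lemma sum_pairs_eq_two_mul (f : Fin n → Fin n → Prop) (hs : ∀ i j, f i j ↔ f j i)
    (hd : ∀ i, ¬ f i i) :
    ∑ i, ∑ j, (if f i j then 1 else 0) = 2 *
      (Finset.univ.filter (fun p : Fin n × Fin n => p.1 < p.2 ∧ f p.1 p.2)).card := by
  have h0 : ∑ i, ∑ j, (if f i j then 1 else 0)
      = (Finset.univ.filter (fun p : Fin n × Fin n => f p.1 p.2)).card := by
    rw [Finset.card_filter, ← Finset.univ_product_univ, Finset.sum_product]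
  have h1 : Finset.univ.filter (fun p : Fin n × Fin n => f p.1 p.2)
      = Finset.univ.filter (fun p : Fin n × Fin n => p.1 < p.2 ∧ f p.1 p.2)
        ∪ Finset.univ.filter (fun p : Fin n × Fin n => p.2 < p.1 ∧ f p.1 p.2) := by
    ext ⟨i, j⟩
    simp only [Finset.mem_filter, Finset.mem_univ, true_and, Finset.mem_union]
    constructor
    · intro h
      rcases lt_trichotomy i j with hij | rfl | hij
      · exact Or.inl ⟨hij, h⟩
      · exact absurd h (hd i)
      · exact Or.inr ⟨hij, h⟩
    · rintro (h | h) <;> exact h.2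
  have h2 : (Finset.univ.filter (fun p : Fin n × Fin n => p.2 < p.1 ∧ f p.1 p.2)).card
      = (Finset.univ.filter (fun p : Fin n × Fin n => p.1 < p.2 ∧ f p.1 p.2)).card := by
    refine Finset.card_bij (fun p _ => (p.2, p.1)) ?_ ?_ ?_
    · rintro ⟨i, j⟩ h
      simpa [hs i j] using h
    · rintro ⟨i, j⟩ _ ⟨i', j'⟩ _ h
      simp only [Prod.mk.injEq] at h ⊢
      exact ⟨h.2, h.1⟩
    · rintro ⟨i, j⟩ h
      exact ⟨(j, i), by simpa [hs i j] using h, rfl⟩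
  rw [h0, h1, Finset.card_union_of_disjoint, h2]
  · ring
  · rw [Finset.disjoint_left]
    rintro ⟨i, j⟩ h h'
    have h3 := (Finset.mem_filter.1 h).2.1
    have h4 := (Finset.mem_filter.1 h').2.1
    exact absurd h3 (not_lt_of_gt h4)

end PairSums

/-- The unordered pair `{i,j}` is an inversion of `y`. -/
def IsInv {n : ℕ} (y : Equiv.Perm (Fin n)) (i j : Fin n) : Prop :=
  (i < j ∧ y j < y i) ∨ (j < i ∧ y i < y j)

/-- There is no point of the graph of `y` strictly inside the rectangle spanned by `a,b`. -/
def NoMid {n : ℕ} (y : Equiv.Perm (Fin n)) (a b : Fin n) : Prop :=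
  ∀ c, a < c → c < b → y a < y c → y c < y b → False

lemma two_mul_invLen {n : ℕ} (y : Equiv.Perm (Fin n)) :
    2 * invLen y = ∑ i, ∑ j, (if IsInv y i j then 1 else 0) := by
  rw [sum_pairs_eq_two_mul (IsInv y) (fun i j => by unfold IsInv; tauto)
    (fun i => by unfold IsInv; simp)]
  unfold invLen
  congr 2
  ext ⟨i, j⟩
  simp only [Finset.mem_filter, Finset.mem_univ, true_and]
  constructor
  · intro h; exact ⟨h.1, Or.inl h⟩
  · rintro ⟨h, h' | h'⟩
    · exact h'
    · exact absurd h (not_lt_of_gt h'.1)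

lemma isInv_split {n : ℕ} (y : Equiv.Perm (Fin n)) {a b : Fin n} (hab : a < b) :
    2 * invLen y = 2 * (if IsInv y a b then 1 else 0)
      + 2 * ∑ c ∈ (Finset.univ.erase a).erase b,
          ((if IsInv y a c then 1 else 0) + (if IsInv y b c then 1 else 0))
      + ∑ c ∈ (Finset.univ.erase a).erase b, ∑ d ∈ (Finset.univ.erase a).erase b,
          (if IsInv y c d then 1 else 0) := by
  rw [two_mul_invLen]
  refine sum_pairs_split (fun i j => if IsInv y i j then 1 else 0) (fun i j => ?_) (fun i => ?_)
    hab.ne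
  · have : IsInv y i j ↔ IsInv y j i := by unfold IsInv; tauto
    simp [this]
  · simp [IsInv]

lemma isInv_disjoint {n : ℕ} (y : Equiv.Perm (Fin n)) {a b c d : Fin n}
    (hca : c ≠ a) (hcb : c ≠ b) (hda : d ≠ a) (hdb : d ≠ b) :
    IsInv (y * Equiv.swap a b) c d ↔ IsInv y c d := by
  simp [IsInv, Equiv.swap_apply_of_ne_of_ne, hca, hcb, hda, hdb]

lemma isInv_class_le {n : ℕ} (y : Equiv.Perm (Fin n)) {a b c : Fin n} (hab : a < b)
    (hy : y a < y b) (hca : c ≠ a) (hcb : c ≠ b) :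
    (if IsInv y a c then 1 else 0) + (if IsInv y b c then 1 else 0) ≤
    (if IsInv (y * Equiv.swap a b) a c then 1 else 0)
      + (if IsInv (y * Equiv.swap a b) b c then 1 else 0) := by
  have h1 : y c ≠ y a := fun h => hca (y.injective h)
  have h2 : y c ≠ y b := fun h => hcb (y.injective h)
  simp only [IsInv, Equiv.Perm.mul_apply, Equiv.swap_apply_left, Equiv.swap_apply_right,
    Equiv.swap_apply_of_ne_of_ne hca hcb, Fin.lt_def, ne_eq, Fin.ext_iff] at *
  split_ifs <;> omega

lemma isInv_class_eq {n : ℕ} (y : Equiv.Perm (Fin n)) {a b c : Fin n} (hab : a < b)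
    (hy : y a < y b) (hca : c ≠ a) (hcb : c ≠ b) (hm : NoMid y a b) :
    (if IsInv (y * Equiv.swap a b) a c then 1 else 0)
      + (if IsInv (y * Equiv.swap a b) b c then 1 else 0) =
    (if IsInv y a c then 1 else 0) + (if IsInv y b c then 1 else 0) := by
  have h1 : y c ≠ y a := fun h => hca (y.injective h)
  have h2 : y c ≠ y b := fun h => hcb (y.injective h)
  have h3 : ¬ (a < c ∧ c < b ∧ y a < y c ∧ y c < y b) := fun h => hm c h.1 h.2.1 h.2.2.1 h.2.2.2
  simp only [IsInv, Equiv.Perm.mul_apply, Equiv.swap_apply_left, Equiv.swap_apply_right,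
    Equiv.swap_apply_of_ne_of_ne hca hcb, Fin.lt_def, ne_eq, Fin.ext_iff] at *
  split_ifs <;> omega

lemma invLen_lt_mul_swap {n : ℕ} (y : Equiv.Perm (Fin n)) {a b : Fin n} (hab : a < b)
    (hy : y a < y b) : invLen y < invLen (y * Equiv.swap a b) := by
  have e1 := isInv_split y hab
  have e2 := isInv_split (y * Equiv.swap a b) hab
  have i1 : ¬ IsInv y a b := by
    rintro (h | h)
    · exact absurd hy (not_lt_of_gt h.2)
    · exact absurd hab (not_lt_of_gt h.1)
  have i2 : IsInv (y * Equiv.swap a b) a b := Or.inl ⟨hab, by simpa using hy⟩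
  have h3 : ∀ c ∈ (Finset.univ.erase a).erase b, _ := fun c hc =>
    isInv_class_le y hab hy (Finset.ne_of_mem_erase (Finset.mem_of_mem_erase hc))
      (Finset.ne_of_mem_erase hc)
  have h3' := Finset.sum_le_sum h3
  have h4 : ∑ c ∈ (Finset.univ.erase a).erase b, ∑ d ∈ (Finset.univ.erase a).erase b,
          (if IsInv (y * Equiv.swap a b) c d then 1 else 0)
      = ∑ c ∈ (Finset.univ.erase a).erase b, ∑ d ∈ (Finset.univ.erase a).erase b,
          (if IsInv y c d then 1 else 0) := by
    refine Finset.sum_congr rfl fun c hc => Finset.sum_congr rfl fun d hd => ?_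
    simp only [Finset.mem_erase, Finset.mem_univ, and_true] at hc hd
    simp only [isInv_disjoint y hc.2 hc.1 hd.2 hd.1]
  rw [h4] at e2
  simp only [if_neg i1, if_pos i2] at e1 e2
  omega

lemma invLen_mul_swap_of_noMid {n : ℕ} (y : Equiv.Perm (Fin n)) {a b : Fin n} (hab : a < b)
    (hy : y a < y b) (hm : NoMid y a b) : invLen (y * Equiv.swap a b) = invLen y + 1 := by
  have e1 := isInv_split y hab
  have e2 := isInv_split (y * Equiv.swap a b) hab
  have i1 : ¬ IsInv y a b := by
    rintro (h | h)
    · exact absurd hy (not_lt_of_gt h.2)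
    · exact absurd hab (not_lt_of_gt h.1)
  have i2 : IsInv (y * Equiv.swap a b) a b := Or.inl ⟨hab, by simpa using hy⟩
  have h3 := Finset.sum_congr (s₁ := (Finset.univ.erase a).erase b) rfl fun c hc =>
    isInv_class_eq y hab hy (Finset.ne_of_mem_erase (Finset.mem_of_mem_erase hc))
      (Finset.ne_of_mem_erase hc) hm
  have h4 : ∑ c ∈ (Finset.univ.erase a).erase b, ∑ d ∈ (Finset.univ.erase a).erase b,
          (if IsInv (y * Equiv.swap a b) c d then 1 else 0)
      = ∑ c ∈ (Finset.univ.erase a).erase b, ∑ d ∈ (Finset.univ.erase a).erase b,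
          (if IsInv y c d then 1 else 0) := by
    refine Finset.sum_congr rfl fun c hc => Finset.sum_congr rfl fun d hd => ?_
    simp only [Finset.mem_erase, Finset.mem_univ, and_true] at hc hd
    simp only [isInv_disjoint y hc.2 hc.1 hd.2 hd.1]
  rw [h4, h3] at e2
  simp only [if_neg i1, if_pos i2] at e1 e2
  omega

lemma invLen_lt_mul_swap_iff {n : ℕ} (y : Equiv.Perm (Fin n)) {a b : Fin n} (hab : a < b) :
    invLen y < invLen (y * Equiv.swap a b) ↔ y a < y b := by
  refine ⟨fun h => ?_, invLen_lt_mul_swap y hab⟩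
  by_contra hn
  have hne : y a ≠ y b := fun h => hab.ne (y.injective h)
  have hlt : y b < y a := lt_of_le_of_ne (not_lt.1 hn) hne.symm
  have := invLen_lt_mul_swap (y * Equiv.swap a b) hab (by simpa using hlt)
  rw [mul_assoc, Equiv.swap_mul_self, mul_one] at this
  omega

lemma swap_mem_R_iff {n : ℕ} {y w : Equiv.Perm (Fin n)} (hyw : bruhatLE y w) {a b : Fin n}
    (hab : a < b) : Equiv.swap a b ∈ R y w ↔ Up y w a b := by
  unfold R Up
  simp only [Set.mem_ofPred_eq, invLen_lt_mul_swap_iff y hab]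
  constructor
  · rintro ⟨_, h1, h2⟩
    exact ⟨hab, h1, (bruhatLE_mul_swap_iff hyw hab h1).1 h2⟩
  · rintro ⟨_, h1, h2⟩
    exact ⟨⟨a, b, hab.ne, rfl⟩, h1, (bruhatLE_mul_swap_iff hyw hab h1).2 h2⟩

lemma ncard_R {n : ℕ} {y w : Equiv.Perm (Fin n)} (hyw : bruhatLE y w) :
    (R y w).ncard = (Finset.univ.filter (fun p : Fin n × Fin n => Up y w p.1 p.2)).card := by
  have : R y w = ((Finset.univ.filter (fun p : Fin n × Fin n => Up y w p.1 p.2)).image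
      (fun p => Equiv.swap p.1 p.2) : Finset (Equiv.Perm (Fin n))) := by
    ext t
    simp only [Finset.coe_image, Finset.coe_filter, Finset.mem_univ, true_and, Set.mem_image,
      Set.mem_ofPred_eq, Prod.exists]
    constructor
    · intro ht
      obtain ⟨a, b, hab, rfl⟩ := ht.1
      rcases lt_or_gt_of_ne hab with h | h
      · exact ⟨a, b, (swap_mem_R_iff hyw h).1 ht, rfl⟩
      · rw [Equiv.swap_comm] at ht
        exact ⟨b, a, (swap_mem_R_iff hyw h).1 ht, Equiv.swap_comm _ _⟩
    · rintro ⟨a, b, h, rfl⟩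
      exact (swap_mem_R_iff hyw h.1).2 h
  rw [this, Set.ncard_coe_finset, Finset.card_image_of_injOn]
  rintro ⟨a, b⟩ h ⟨c, d⟩ h' heq
  have h1 : a < b := (Finset.mem_filter.1 h).2.1
  have h2 : c < d := (Finset.mem_filter.1 h').2.1
  simp only at heq
  have e1 : Equiv.swap c d a = b := by rw [← heq]; simp
  by_cases hac : a = c
  · subst hac
    simp only [Equiv.swap_apply_left] at e1
    rw [e1]
  · by_cases had : a = d
    · subst had
      simp only [Equiv.swap_apply_right] at e1
      subst e1
      exact absurd h1 (not_lt_of_gt h2)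
    · rw [Equiv.swap_apply_of_ne_of_ne hac had] at e1
      exact absurd h1 (by rw [e1]; exact lt_irrefl _)

/-- Symmetrised version of `Up`. -/
def UpS {n : ℕ} (y w : Equiv.Perm (Fin n)) (i j : Fin n) : Prop := Up y w i j ∨ Up y w j i

lemma upS_of_lt {n : ℕ} {y w : Equiv.Perm (Fin n)} {i j : Fin n} (h : i < j) :
    UpS y w i j ↔ Up y w i j :=
  ⟨fun h' => h'.elim id fun h' => absurd h'.1 (not_lt_of_gt h), Or.inl⟩

lemma upS_of_gt {n : ℕ} {y w : Equiv.Perm (Fin n)} {i j : Fin n} (h : j < i) :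
    UpS y w i j ↔ Up y w j i :=
  ⟨fun h' => h'.elim (fun h' => absurd h'.1 (not_lt_of_gt h)) id, Or.inr⟩

lemma two_mul_ncard_R {n : ℕ} {y w : Equiv.Perm (Fin n)} (hyw : bruhatLE y w)
    {a b : Fin n} (hab : a < b) :
    2 * (R y w).ncard = 2 * (if UpS y w a b then 1 else 0)
      + 2 * ∑ c ∈ (Finset.univ.erase a).erase b,
          ((if UpS y w a c then 1 else 0) + (if UpS y w b c then 1 else 0))
      + ∑ c ∈ (Finset.univ.erase a).erase b, ∑ d ∈ (Finset.univ.erase a).erase b,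
          (if UpS y w c d then 1 else 0) := by
  have hs : ∀ i j, UpS y w i j ↔ UpS y w j i := fun i j => or_comm
  have hd : ∀ i, ¬ UpS y w i i := fun i h => h.elim (fun h => lt_irrefl _ h.1)
    (fun h => lt_irrefl _ h.1)
  have h1 := sum_pairs_eq_two_mul (UpS y w) hs hd
  have h2 := sum_pairs_split (fun i j => if UpS y w i j then 1 else 0)
    (fun i j => by simp [hs i j]) (fun i => by simp [hd i]) hab.ne
  rw [← h2, h1, ncard_R hyw]
  congr 2
  ext ⟨i, j⟩
  simp only [Finset.mem_filter, Finset.mem_univ, true_and]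
  constructor
  · intro h; exact ⟨h.1, Or.inl h⟩
  · rintro ⟨h, h'⟩; exact (upS_of_lt h).1 h'

lemma posBox_split_left {d : ℕ → ℕ → ℤ} {a b c q r : ℕ} (h1 : a ≤ b) (h2 : b ≤ c) :
    PosBox d a c q r ↔ PosBox d a b q r ∧ PosBox d b c q r := by
  constructor
  · intro h
    exact ⟨fun p s h3 h4 => h p s h3 (h4.trans h2), fun p s h3 h4 => h p s (by omega) h4⟩
  · rintro ⟨h, h'⟩ p s h3 h4 h5 h6
    rcases le_or_gt p b with hp | hp
    · exact h p s h3 hp h5 h6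
    · exact h' p s hp h4 h5 h6

lemma posBox_split_right {d : ℕ → ℕ → ℤ} {a b p q r : ℕ} (h1 : p ≤ q) (h2 : q ≤ r) :
    PosBox d a b p r ↔ PosBox d a b p q ∧ PosBox d a b q r := by
  constructor
  · intro h
    exact ⟨fun u s h3 h4 h5 h6 => h u s h3 h4 h5 (h6.trans h2),
      fun u s h3 h4 h5 h6 => h u s h3 h4 (by omega) h6⟩
  · rintro ⟨h, h'⟩ u s h3 h4 h5 h6
    rcases le_or_gt s q with hp | hp
    · exact h u s h3 h4 h5 hp
    · exact h' u s h3 h4 hp h6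

lemma posBox_mul_swap_of_disjoint {n : ℕ} (y w : Equiv.Perm (Fin n)) {a b : Fin n} (hab : a < b)
    (hy : y a < y b) {p₁ p₂ q₁ q₂ : ℕ}
    (h : p₂ ≤ a ∨ (b : ℕ) ≤ p₁ ∨ q₂ ≤ y a ∨ (y b : ℕ) ≤ q₁) :
    PosBox (dd (y * Equiv.swap a b) w) p₁ p₂ q₁ q₂ ↔ PosBox (dd y w) p₁ p₂ q₁ q₂ := by
  unfold PosBox
  refine forall_congr' fun p => forall_congr' fun q => ?_
  refine imp_congr_right fun h1 => imp_congr_right fun h2 => imp_congr_right fun h3 =>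
    imp_congr_right fun h4 => ?_
  rw [dd_mul_swap y w hab hy, if_neg (by omega), sub_zero]

lemma dd_mul_swap_le {n : ℕ} (y w : Equiv.Perm (Fin n)) {a b : Fin n} (hab : a < b)
    (hy : y a < y b) (p q : ℕ) : dd (y * Equiv.swap a b) w p q ≤ dd y w p q := by
  rw [dd_mul_swap y w hab hy]
  split_ifs <;> omega

lemma posBox_of_mul_swap {n : ℕ} {y w : Equiv.Perm (Fin n)} {a b : Fin n} (hab : a < b)
    (hy : y a < y b) {p₁ p₂ q₁ q₂ : ℕ} (h : PosBox (dd (y * Equiv.swap a b) w) p₁ p₂ q₁ q₂) :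
    PosBox (dd y w) p₁ p₂ q₁ q₂ := fun p q h1 h2 h3 h4 =>
  (h p q h1 h2 h3 h4).trans (dd_mul_swap_le y w hab hy p q)

lemma up_of_mul_swap_of_disjoint {n : ℕ} {y w : Equiv.Perm (Fin n)} {a b c d : Fin n}
    (hab : a < b) (hy : y a < y b) (hca : c ≠ a) (hcb : c ≠ b) (hda : d ≠ a) (hdb : d ≠ b)
    (h : Up (y * Equiv.swap a b) w c d) : Up y w c d := by
  obtain ⟨h1, h2, h3⟩ := h
  simp only [Equiv.Perm.mul_apply, Equiv.swap_apply_of_ne_of_ne hca hcb,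
    Equiv.swap_apply_of_ne_of_ne hda hdb] at h2 h3
  exact ⟨h1, h2, posBox_of_mul_swap hab hy h3⟩

/-- The strict case of `upS_class`: `c` lies to the upper right, or to the lower left, of both
`a` and `b`. -/
def StrictAt {n : ℕ} (y w : Equiv.Perm (Fin n)) (a b c : Fin n) : Prop :=
  (b < c ∧ y b < y c ∧ Up y w b c ∧ ¬ PosBox (dd y w) a b (y b) (y c) ∧
    ¬ PosBox (dd y w) b c (y a) (y b)) ∨
  (c < a ∧ y c < y a ∧ Up y w c a ∧ ¬ PosBox (dd y w) c a (y a) (y b) ∧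
    ¬ PosBox (dd y w) a b (y c) (y a))

lemma upS_class {n : ℕ} {y w : Equiv.Perm (Fin n)} {a b c : Fin n} (hu : Up y w a b)
    (hca : c ≠ a) (hcb : c ≠ b) :
    (if UpS (y * Equiv.swap a b) w a c then 1 else 0)
      + (if UpS (y * Equiv.swap a b) w b c then 1 else 0)
      ≤ (if UpS y w a c then 1 else 0) + (if UpS y w b c then 1 else 0) ∧
    (NoMid y a b → (StrictAt y w a b c ↔ (if UpS (y * Equiv.swap a b) w a c then 1 else 0)
      + (if UpS (y * Equiv.swap a b) w b c then 1 else 0)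
      < (if UpS y w a c then 1 else 0) + (if UpS y w b c then 1 else 0))) := by
  obtain ⟨hab, hy, hbox⟩ := hu
  have n1 : y c ≠ y a := fun h => hca (y.injective h)
  have n2 : y c ≠ y b := fun h => hcb (y.injective h)
  have va : (y * Equiv.swap a b) a = y b := by simp
  have vb : (y * Equiv.swap a b) b = y a := by simp
  have vc : (y * Equiv.swap a b) c = y c := by
    simp [Equiv.swap_apply_of_ne_of_ne hca hcb]
  have hab' : (a : ℕ) ≤ b := hab.le
  have hy' : (y a : ℕ) ≤ y b := hy.le
  have dis : ∀ {p₁ p₂ q₁ q₂ : ℕ}, _ → _ := @posBox_mul_swap_of_disjoint n y w a b hab hy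
  unfold StrictAt
  rcases lt_trichotomy c a with h | h | h
  · have h1 : (c : ℕ) ≤ a := h.le
    have h2 : c < b := h.trans hab
    rw [upS_of_gt h, upS_of_gt h2, upS_of_gt h, upS_of_gt h2]
    unfold Up
    rw [va, vb, vc]
    rcases lt_trichotomy (y c) (y a) with g | g | g
    · have g1 : (y c : ℕ) ≤ y a := g.le
      have g2 : y c < y b := g.trans hy
      rw [dis (p₂ := a) (Or.inl le_rfl), dis (q₂ := y a) (Or.inr (Or.inr (Or.inl le_rfl))),
        posBox_split_left (c := b) h1 hab', posBox_split_left (c := b) h1 hab',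
        posBox_split_right (p := y c) (q := y a) (r := y b) g1 hy',
        posBox_split_right (p := y c) (q := y a) (r := y b) g1 hy']
      have := h2.not_gt
      have := h.not_gt
      split_ifs <;> grind
    · exact absurd g n1
    · rcases lt_trichotomy (y c) (y b) with g2 | g2 | g2
      · have := dis (p₁ := c) (p₂ := a) (q₁ := y c) (q₂ := y b) (Or.inl le_rfl)
        rw [this]
        have g3 : PosBox (dd y w) a b (y c) (y b) := fun p q h1 h2 h3 h4 =>
          hbox p q h1 h2 (by have := Fin.lt_def.1 g; omega) h4
        have := posBox_split_left (d := dd y w) (q := y c) (r := y b) h1 hab'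
        have := h2.not_gt
        have := h.not_gt
        have := g.not_gt
        split_ifs <;> grind
      · exact absurd g2 n2
      · have := g2.not_gt
        have := g.not_gt
        split_ifs <;> grind
  · exact absurd h hca
  · rcases lt_trichotomy c b with h2 | h2 | h2
    · have h1 : (a : ℕ) ≤ c := h.le
      rw [upS_of_lt h, upS_of_gt h2, upS_of_lt h, upS_of_gt h2]
      unfold Up
      rw [va, vb, vc]
      have e1 := h.not_gt
      have e2 := h2.not_gt
      rcases lt_trichotomy (y c) (y a) with g | g | g
      · have e3 := g.not_gt
        have e4 : y c < y b := g.trans hy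
        have e5 := e4.not_gt
        rw [dis (q₂ := y a) (Or.inr (Or.inr (Or.inl le_rfl))),
          posBox_split_right (p := y c) (q := y a) (r := y b) g.le hy']
        have g3 : PosBox (dd y w) c b (y a) (y b) := fun p q h3 h4 h5 h6 =>
          hbox p q (by have := Fin.lt_def.1 h; omega) h4 h5 h6
        split_ifs <;> grind
      · exact absurd g n1
      · have e3 := g.not_gt
        rcases lt_trichotomy (y c) (y b) with g2 | g2 | g2
        · have e5 := g2.not_gt
          refine ⟨by split_ifs <;> grind, fun hm => ?_⟩
          exact (hm c h h2 g g2).elim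
        · exact absurd g2 n2
        · have e5 := g2.not_gt
          rw [dis (q₁ := y b) (Or.inr (Or.inr (Or.inr le_rfl))),
            posBox_split_right (p := y a) (q := y b) (r := y c) hy' g2.le]
          have g3 : PosBox (dd y w) a c (y a) (y b) := fun p q h3 h4 h5 h6 =>
            hbox p q h3 (by have := Fin.lt_def.1 h2; omega) h5 h6
          split_ifs <;> grind
    · exact absurd h2 hcb
    · have h1 : (b : ℕ) ≤ c := h2.le
      rw [upS_of_lt h, upS_of_lt h2, upS_of_lt h, upS_of_lt h2]
      unfold Up
      rw [va, vb, vc]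
      have e1 := h.not_gt
      have e2 := h2.not_gt
      rcases lt_trichotomy (y c) (y b) with g | g | g
      · have e3 := g.not_gt
        rw [dis (p₁ := b) (Or.inr (Or.inl le_rfl))]
        have := posBox_split_left (d := dd y w) (q := y a) (r := y c) hab' h1
        have g3 : PosBox (dd y w) a b (y a) (y c) := fun p q h3 h4 h5 h6 =>
          hbox p q h3 h4 h5 (by have := Fin.lt_def.1 g; omega)
        split_ifs <;> grind
      · exact absurd g n2
      · have g2 : y a < y c := hy.trans g
        have e3 := g.not_gt
        rw [dis (p₁ := b) (Or.inr (Or.inl le_rfl)),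
          dis (q₁ := y b) (Or.inr (Or.inr (Or.inr le_rfl))),
          posBox_split_left (c := c) hab' h1, posBox_split_left (c := c) hab' h1,
          posBox_split_right (p := y a) (q := y b) (r := y c) hy' g.le,
          posBox_split_right (p := y a) (q := y b) (r := y c) hy' g.le]
        split_ifs <;> grind

lemma upS_disjoint_imp {n : ℕ} {y w : Equiv.Perm (Fin n)} {a b c d : Fin n}
    (hab : a < b) (hy : y a < y b) (hca : c ≠ a) (hcb : c ≠ b) (hda : d ≠ a) (hdb : d ≠ b)
    (h : UpS (y * Equiv.swap a b) w c d) : UpS y w c d :=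
  h.imp (up_of_mul_swap_of_disjoint hab hy hca hcb hda hdb)
    (up_of_mul_swap_of_disjoint hab hy hda hdb hca hcb)

lemma Up.bruhatLE {n : ℕ} {y w : Equiv.Perm (Fin n)} {a b : Fin n} (h : Up y w a b)
    (hyw : bruhatLE y w) : bruhatLE (y * Equiv.swap a b) w :=
  (bruhatLE_mul_swap_iff hyw h.1 h.2.1).2 h.2.2

lemma not_upS_mul_swap {n : ℕ} {y w : Equiv.Perm (Fin n)} {a b : Fin n} (h : Up y w a b) :
    ¬ UpS (y * Equiv.swap a b) w a b := by
  rw [upS_of_lt h.1]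
  rintro ⟨_, h2, _⟩
  simp only [Equiv.Perm.mul_apply, Equiv.swap_apply_left, Equiv.swap_apply_right] at h2
  exact absurd h.2.1 h2.not_gt

/-- Multiplying by an element of `R` loses at least one element of `R`, and exactly one only if
no pair class loses anything. -/
lemma ncard_R_mul_swap {n : ℕ} {y w : Equiv.Perm (Fin n)} {a b : Fin n} (hyw : bruhatLE y w)
    (hu : Up y w a b) :
    (R (y * Equiv.swap a b) w).ncard + 1 ≤ (R y w).ncard ∧
    ((R (y * Equiv.swap a b) w).ncard + 1 = (R y w).ncard ↔
      (∀ c, c ≠ a → c ≠ b →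
        (if UpS (y * Equiv.swap a b) w a c then 1 else 0)
          + (if UpS (y * Equiv.swap a b) w b c then 1 else 0)
          = (if UpS y w a c then 1 else 0) + (if UpS y w b c then 1 else 0)) ∧
      ∀ c d, c ≠ a → c ≠ b → d ≠ a → d ≠ b →
        UpS y w c d → UpS (y * Equiv.swap a b) w c d) := by
  have e1 := two_mul_ncard_R hyw hu.1
  have e2 := two_mul_ncard_R (hu.bruhatLE hyw) hu.1
  rw [if_pos ((upS_of_lt hu.1).2 hu)] at e1
  rw [if_neg (not_upS_mul_swap hu)] at e2
  set s := (Finset.univ.erase a).erase b with hs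
  have mem : ∀ c, c ∈ s ↔ c ≠ a ∧ c ≠ b := fun c => by
    simp [hs, and_comm]
  have k1 : ∀ c ∈ s, _ := fun c hc => (upS_class hu ((mem c).1 hc).1 ((mem c).1 hc).2).1
  have k2 : ∀ c ∈ s, ∀ d ∈ s, (if UpS (y * Equiv.swap a b) w c d then 1 else 0)
      ≤ (if UpS y w c d then 1 else 0) := by
    intro c hc d hd
    have := upS_disjoint_imp (w := w) hu.1 hu.2.1 ((mem c).1 hc).1 ((mem c).1 hc).2
      ((mem d).1 hd).1 ((mem d).1 hd).2
    split_ifs <;> simp_all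
  have k3 := fun c hc => Finset.sum_le_sum (k2 c hc)
  have t1 := Finset.sum_le_sum k1
  have t2 := Finset.sum_le_sum k3
  refine ⟨by omega, ?_⟩
  have r1 := Finset.sum_eq_sum_iff_of_le k1
  have r2 := Finset.sum_eq_sum_iff_of_le k3
  constructor
  · intro h
    have q1 := r1.1 (by omega)
    have q2 := r2.1 (by omega)
    refine ⟨fun c h1 h2 => q1 c ((mem c).2 ⟨h1, h2⟩), fun c d h1 h2 h3 h4 h5 => ?_⟩
    have q3 := (Finset.sum_eq_sum_iff_of_le (k2 c ((mem c).2 ⟨h1, h2⟩))).1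
      (q2 c ((mem c).2 ⟨h1, h2⟩)) d ((mem d).2 ⟨h3, h4⟩)
    by_contra h6
    simp [h5, h6] at q3
  · rintro ⟨h1, h2⟩
    have q1 := r1.2 fun c hc => h1 c ((mem c).1 hc).1 ((mem c).1 hc).2
    have q2 := r2.2 fun c hc => Finset.sum_congr rfl fun d hd => by
      have := h2 c d ((mem c).1 hc).1 ((mem c).1 hc).2 ((mem d).1 hd).1 ((mem d).1 hd).2
      have := k2 c hc d hd
      split_ifs at * <;> simp_all
    omega

lemma invLen_le_sq {n : ℕ} (y : Equiv.Perm (Fin n)) : invLen y ≤ n * n := by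
  unfold invLen
  refine (Finset.card_le_univ _).trans ?_
  simp

/-- Chain property of the Bruhat order: below `w` there is always a cover to go up to. -/
lemma exists_up_noMid {n : ℕ} {y w : Equiv.Perm (Fin n)} (hyw : bruhatLE y w) (hne : y ≠ w) :
    ∃ a b, Up y w a b ∧ NoMid y a b := by
  rw [bruhatLE_iff] at hyw
  have step := fun (p : Fin n) (q : ℕ) => rk_succ_left w p q
  have step' := fun (p : Fin n) (q : ℕ) => rk_succ_left y p q
  have hex : ∃ i, ∃ h : i < n, y ⟨i, h⟩ ≠ w ⟨i, h⟩ := by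
    by_contra hcon
    push Not at hcon
    exact hne (Equiv.ext fun i => hcon i i.2)
  obtain ⟨hi, hiw⟩ := Nat.find_spec hex
  have hmin := fun m (hm : m < Nat.find hex) => Nat.find_min hex hm
  set i0 := Nat.find hex
  set i : Fin n := ⟨i0, hi⟩ with hidef
  have hagree : ∀ c : Fin n, c < i → y c = w c := by
    intro c hc
    by_contra h
    exact hmin c hc ⟨c.2, h⟩
  have hzero : ∀ p, p ≤ i0 → ∀ q, dd y w p q = 0 := by
    intro p
    induction p with
    | zero => intro _ q; simp [dd, rk_zero_left]
    | succ p ih =>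
      intro hp q
      have h1 := step ⟨p, by omega⟩ q
      have h2 := step' ⟨p, by omega⟩ q
      have h3 := ih (by omega) q
      have h4 := hagree ⟨p, by omega⟩ (Fin.lt_def.2 (by simpa [hidef] using hp))
      rw [h4] at h2
      unfold dd at h3 ⊢
      simp only at h1 h2
      omega
  have hlt : y i < w i := by
    by_contra hcon
    have h0 : (w i : ℕ) < y i := Fin.lt_def.1 (lt_of_le_of_ne (not_lt.1 hcon) (Ne.symm hiw))
    have h1 := step i (y i)
    have h2 := step' i (y i)
    have h3 := hzero i0 le_rfl (y i)
    have h4 := hyw (i0 + 1) (y i)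
    unfold dd at h3 h4
    simp only [hidef] at h0 h1 h2 h3 h4
    rw [if_neg (by omega)] at h1
    rw [if_pos le_rfl] at h2
    omega
  have hexj : ∃ j, ∃ h : j < n, i0 < j ∧ y i < y ⟨j, h⟩ ∧ y ⟨j, h⟩ ≤ w i := by
    refine ⟨(y.symm (w i)), (y.symm (w i)).2, ?_, by simpa using hlt, by simp⟩
    by_contra hcon
    rcases lt_or_eq_of_le (not_lt.1 hcon) with h | h
    · have h1 := hagree (y.symm (w i)) (Fin.lt_def.2 h)
      simp only [Equiv.apply_symm_apply] at h1
      have := w.injective h1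
      rw [← this] at h
      exact absurd h (lt_irrefl _)
    · have h1 : y.symm (w i) = i := Fin.ext h
      rw [Equiv.symm_apply_eq] at h1
      exact hiw h1.symm
  obtain ⟨hj, hij, hyj, hjw⟩ := Nat.find_spec hexj
  have hminj := fun m (hm : m < Nat.find hexj) => Nat.find_min hexj hm
  set j0 := Nat.find hexj
  set j : Fin n := ⟨j0, hj⟩ with hjdef
  have hout : ∀ c : Fin n, i < c → c < j → ¬ (y i < y c ∧ y c ≤ w i) := by
    intro c h1 h2 h3
    exact hminj c h2 ⟨c.2, h1, h3⟩
  refine ⟨i, j, ⟨Fin.lt_def.2 hij, hyj, ?_⟩, ?_⟩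
  · intro p q h1 h2 h3 h4
    have key : ∀ p, i0 < p → p ≤ j0 → 1 ≤ dd y w p q - dd y w p (w i + 1) := by
      intro p
      induction p with
      | zero => intro h; omega
      | succ p ih =>
        intro h5 h6
        have a1 := step ⟨p, by omega⟩ q
        have a2 := step' ⟨p, by omega⟩ q
        have a3 := step ⟨p, by omega⟩ (w i + 1)
        have a4 := step' ⟨p, by omega⟩ (w i + 1)
        have hyj' : (y j : ℕ) ≤ w i := hjw
        have hlt' : (y i : ℕ) < w i := hlt
        simp only at a1 a2 a3 a4
        rcases Nat.eq_or_lt_of_le (Nat.lt_succ_iff.1 h5) with h7 | h7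
        · have z1 := hzero p (by omega) q
          have z2 := hzero p (by omega) (w i + 1)
          have e : (⟨p, by omega⟩ : Fin n) = i := Fin.ext h7.symm
          rw [e] at a1 a2 a3 a4
          unfold dd at z1 z2 ⊢
          split_ifs at a1 a2 a3 a4 <;> omega
        · have z := ih h7 (by omega)
          have ho := hout ⟨p, by omega⟩ (Fin.lt_def.2 h7) (Fin.lt_def.2 (by simp only [hjdef]; omega))
          rw [Fin.lt_def, Fin.le_def] at ho
          unfold dd at z ⊢
          split_ifs at a1 a2 a3 a4 <;> omega
    have h5 := key p h1 h2
    have h6 := hyw p (w i + 1)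
    omega
  · intro c h1 h2 h3 h4
    exact hout c h1 h2 ⟨h3, (h4.trans_le hjw).le⟩

/-- Deodhar's inequality. -/
lemma deodhar {n : ℕ} (w : Equiv.Perm (Fin n)) :
    ∀ (N : ℕ) (y : Equiv.Perm (Fin n)), n * n - invLen y ≤ N → bruhatLE y w →
      invLen w ≤ invLen y + (R y w).ncard := by
  intro N
  induction N with
  | zero =>
    intro y h _
    have := invLen_le_sq w
    omega
  | succ N ih =>
    intro y h hyw
    by_cases hne : y = w
    · subst hne; omega
    obtain ⟨a, b, hu, hm⟩ := exists_up_noMid hyw hne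
    have h1 := invLen_mul_swap_of_noMid y hu.1 hu.2.1 hm
    have h2 := ih (y * Equiv.swap a b) (by omega) (hu.bruhatLE hyw)
    have h3 := (ncard_R_mul_swap hyw hu).1
    omega

/-- `y` is a rationally smooth point below `w`. -/
def Smooth {n : ℕ} (y w : Equiv.Perm (Fin n)) : Prop :=
  bruhatLE y w ∧ (R y w).ncard + invLen y = invLen w

lemma Smooth.ncard_eq {n : ℕ} {y w : Equiv.Perm (Fin n)} {a b : Fin n} (hs : Smooth y w)
    (hu : Up y w a b) (hm : NoMid y a b) :
    (R (y * Equiv.swap a b) w).ncard + 1 = (R y w).ncard := by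
  have h1 := invLen_mul_swap_of_noMid y hu.1 hu.2.1 hm
  have h2 := deodhar w _ (y * Equiv.swap a b) le_rfl (hu.bruhatLE hs.1)
  have h3 := (ncard_R_mul_swap hs.1 hu).1
  have h4 := hs.2
  omega

lemma Smooth.up_mul_swap {n : ℕ} {y w : Equiv.Perm (Fin n)} {a b c d : Fin n} (hs : Smooth y w)
    (hu : Up y w a b) (hm : NoMid y a b) (hcd : Up y w c d)
    (hca : c ≠ a) (hcb : c ≠ b) (hda : d ≠ a) (hdb : d ≠ b) :
    Up (y * Equiv.swap a b) w c d := by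
  have h := ((ncard_R_mul_swap hs.1 hu).2.1 (hs.ncard_eq hu hm)).2 c d hca hcb hda hdb
    ((upS_of_lt hcd.1).2 hcd)
  exact (upS_of_lt hcd.1).1 h

/-- Two disjoint edges at a smooth point, one of which is a cover, force `d ≥ 2` on the
intersection of their boxes. -/
lemma Smooth.two_le {n : ℕ} {y w : Equiv.Perm (Fin n)} {a b c d : Fin n} (hs : Smooth y w)
    (hu : Up y w a b) (hm : NoMid y a b) (hcd : Up y w c d)
    (hca : c ≠ a) (hcb : c ≠ b) (hda : d ≠ a) (hdb : d ≠ b) {p q : ℕ}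
    (h1 : (a : ℕ) < p) (h2 : p ≤ b) (h3 : (y a : ℕ) < q) (h4 : q ≤ y b)
    (h5 : (c : ℕ) < p) (h6 : p ≤ d) (h7 : (y c : ℕ) < q) (h8 : q ≤ y d) : 2 ≤ dd y w p q := by
  have h := (hs.up_mul_swap hu hm hcd hca hcb hda hdb).2.2 p q h5 h6
  simp only [Equiv.Perm.mul_apply, Equiv.swap_apply_of_ne_of_ne hca hcb,
    Equiv.swap_apply_of_ne_of_ne hda hdb] at h
  have := h h7 h8
  rw [dd_mul_swap y w hu.1 hu.2.1, if_pos ⟨h1, h2, h3, h4⟩] at this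
  omega

lemma Smooth.not_strictAt {n : ℕ} {y w : Equiv.Perm (Fin n)} {a b c : Fin n} (hs : Smooth y w)
    (hu : Up y w a b) (hm : NoMid y a b) (hca : c ≠ a) (hcb : c ≠ b) : ¬ StrictAt y w a b c := by
  have h := ((ncard_R_mul_swap hs.1 hu).2.1 (hs.ncard_eq hu hm)).1 c hca hcb
  rw [(upS_class hu hca hcb).2 hm]
  omega

lemma Smooth.posBox_or {n : ℕ} {y w : Equiv.Perm (Fin n)} {a b c : Fin n} (hs : Smooth y w)
    (hab : Up y w a b) (hbc : Up y w b c) (hm : NoMid y a b ∨ NoMid y b c) :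
    PosBox (dd y w) a b (y b) (y c) ∨ PosBox (dd y w) b c (y a) (y b) := by
  by_contra hcon
  push Not at hcon
  rcases hm with hm | hm
  · exact hs.not_strictAt hab hm (hab.1.trans hbc.1).ne' hbc.1.ne'
      (Or.inl ⟨hbc.1, hbc.2.1, hbc, hcon.1, hcon.2⟩)
  · exact hs.not_strictAt hbc hm hab.1.ne (hab.1.trans hbc.1).ne
      (Or.inr ⟨hab.1, hab.2.1, hab, hcon.1, hcon.2⟩)

/-- A covering edge from a singular point to a smooth one has a failing partner. -/
lemma exists_partner {n : ℕ} {y w : Equiv.Perm (Fin n)} {a b : Fin n} (hyw : bruhatLE y w)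
    (hsing : invLen w < (R y w).ncard + invLen y) (hu : Up y w a b) (hm : NoMid y a b)
    (hs : Smooth (y * Equiv.swap a b) w) :
    (∃ c, c ≠ a ∧ c ≠ b ∧ StrictAt y w a b c) ∨
    ∃ c d, c ≠ a ∧ c ≠ b ∧ d ≠ a ∧ d ≠ b ∧ Up y w c d ∧ ∃ p q, (a : ℕ) < p ∧ p ≤ b ∧
      (y a : ℕ) < q ∧ q ≤ y b ∧ (c : ℕ) < p ∧ p ≤ d ∧ (y c : ℕ) < q ∧ q ≤ y d ∧
      dd y w p q ≤ 1 := by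
  by_contra hcon
  push Not at hcon
  obtain ⟨h1, h2⟩ := hcon
  have h3 := invLen_mul_swap_of_noMid y hu.1 hu.2.1 hm
  have h4 := hs.2
  have h5 : (R (y * Equiv.swap a b) w).ncard + 1 = (R y w).ncard := by
    rw [(ncard_R_mul_swap hyw hu).2]
    constructor
    · intro c hca hcb
      have h6 := h1 c hca hcb
      rw [(upS_class hu hca hcb).2 hm] at h6
      exact le_antisymm (upS_class hu hca hcb).1 (not_lt.1 h6)
    · have key : ∀ c d, c ≠ a → c ≠ b → d ≠ a → d ≠ b → Up y w c d →
          Up (y * Equiv.swap a b) w c d := by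
        intro c d hca hcb hda hdb hcd
        refine ⟨hcd.1, ?_, fun p q => ?_⟩
        · simpa [Equiv.swap_apply_of_ne_of_ne, *] using hcd.2.1
        · simp only [Equiv.Perm.mul_apply, Equiv.swap_apply_of_ne_of_ne hca hcb,
            Equiv.swap_apply_of_ne_of_ne hda hdb]
          intro q1 q2 q3 q4
          rw [dd_mul_swap y w hu.1 hu.2.1]
          have q5 := hcd.2.2 p q q1 q2 q3 q4
          split_ifs with hc
          · have := h2 c d hca hcb hda hdb hcd p q hc.1 hc.2.1 hc.2.2.1 hc.2.2.2 q1 q2 q3 q4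
            omega
          · omega
      intro c d hca hcb hda hdb
      exact Or.imp (key c d hca hcb hda hdb) (key d c hda hdb hca hcb)
  omega

lemma Up.mul_swap_of_sep {n : ℕ} {y w : Equiv.Perm (Fin n)} {a b c d : Fin n}
    (hcd : Up y w c d) (hab : a < b) (hy : y a < y b)
    (hca : c ≠ a) (hcb : c ≠ b) (hda : d ≠ a) (hdb : d ≠ b)
    (hsep : (d : ℕ) ≤ a ∨ (b : ℕ) ≤ c ∨ (y d : ℕ) ≤ y a ∨ (y b : ℕ) ≤ y c) :
    Up (y * Equiv.swap a b) w c d := by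
  refine ⟨hcd.1, ?_, ?_⟩
  · simpa [Equiv.swap_apply_of_ne_of_ne, *] using hcd.2.1
  · simp only [Equiv.Perm.mul_apply, Equiv.swap_apply_of_ne_of_ne hca hcb,
      Equiv.swap_apply_of_ne_of_ne hda hdb]
    rw [posBox_mul_swap_of_disjoint y w hab hy hsep]
    exact hcd.2.2

lemma Up.mul_swap_left {n : ℕ} {y w : Equiv.Perm (Fin n)} {a b c : Fin n}
    (hab : Up y w a b) (hbc : b < c) (hy : y b < y c)
    (h : PosBox (dd y w) a b (y b) (y c)) : Up (y * Equiv.swap b c) w a b := by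
  have h1 := hab.1
  have hac : a ≠ c := (h1.trans hbc).ne
  refine ⟨h1, ?_, ?_⟩
  · simpa [Equiv.swap_apply_of_ne_of_ne h1.ne hac] using hab.2.1.trans hy
  · simp only [Equiv.Perm.mul_apply, Equiv.swap_apply_of_ne_of_ne h1.ne hac,
      Equiv.swap_apply_left]
    rw [posBox_mul_swap_of_disjoint y w hbc hy (Or.inl le_rfl),
      posBox_split_right (q := y b) hab.2.1.le hy.le]
    exact ⟨hab.2.2, h⟩

lemma Up.mul_swap_skip {n : ℕ} {y w : Equiv.Perm (Fin n)} {a b c : Fin n}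
    (hab : Up y w a b) (hbc : b < c) (hy : y b < y c)
    (h : PosBox (dd y w) b c (y a) (y b)) : Up (y * Equiv.swap b c) w a c := by
  have h1 := hab.1
  have hac : a ≠ c := (h1.trans hbc).ne
  refine ⟨h1.trans hbc, ?_, ?_⟩
  · simpa [Equiv.swap_apply_of_ne_of_ne h1.ne hac] using hab.2.1
  · simp only [Equiv.Perm.mul_apply, Equiv.swap_apply_of_ne_of_ne h1.ne hac,
      Equiv.swap_apply_right]
    rw [posBox_mul_swap_of_disjoint y w hbc hy (Or.inr (Or.inr (Or.inl le_rfl))),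
      posBox_split_left (b := b) h1.le hbc.le]
    exact ⟨hab.2.2, h⟩

lemma Up.mul_swap_of_two_le {n : ℕ} {y w : Equiv.Perm (Fin n)} {a b c d : Fin n}
    (hcd : Up y w c d) (hab : a < b) (hy : y a < y b)
    (hca : c ≠ a) (hcb : c ≠ b) (hda : d ≠ a) (hdb : d ≠ b)
    (h : ∀ p q, (a : ℕ) < p → p ≤ b → (y a : ℕ) < q → q ≤ y b → (c : ℕ) < p → p ≤ d →
      (y c : ℕ) < q → q ≤ y d → 2 ≤ dd y w p q) :
    Up (y * Equiv.swap a b) w c d := by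
  refine ⟨hcd.1, ?_, fun p q => ?_⟩
  · simpa [Equiv.swap_apply_of_ne_of_ne, *] using hcd.2.1
  · simp only [Equiv.Perm.mul_apply, Equiv.swap_apply_of_ne_of_ne hca hcb,
      Equiv.swap_apply_of_ne_of_ne hda hdb]
    intro h1 h2 h3 h4
    rw [dd_mul_swap y w hab hy]
    have h5 := hcd.2.2 p q h1 h2 h3 h4
    split_ifs with h6
    · have := h p q h6.1 h6.2.1 h6.2.2.1 h6.2.2.2 h1 h2 h3 h4
      omega
    · omega

/-- The boxes of two edges meet in a point where `d ≤ 1`. -/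
def Clash {n : ℕ} (y w : Equiv.Perm (Fin n)) (a b c d : Fin n) : Prop :=
  ∃ p q, (a : ℕ) < p ∧ p ≤ b ∧ (y a : ℕ) < q ∧ q ≤ y b ∧ (c : ℕ) < p ∧ p ≤ d ∧
    (y c : ℕ) < q ∧ q ≤ y d ∧ dd y w p q ≤ 1

/-- Neither of the two side boxes of the increasing triple `a,b,c` is positive. -/
def Blocked {n : ℕ} (y w : Equiv.Perm (Fin n)) (a b c : Fin n) : Prop :=
  ¬ PosBox (dd y w) a b (y b) (y c) ∧ ¬ PosBox (dd y w) b c (y a) (y b)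

/-- The hypotheses of the main theorem. -/
structure Cfg (n k l m : ℕ) (x w : Equiv.Perm (Fin n)) : Prop where
  msp : MSP x w
  delta : Delta x w = Set.univ
  hk : 1 ≤ k
  hl : 1 ≤ l
  hm : 1 ≤ m
  sum : k + l + m = n
  val : ∀ i : Fin n, (x i : ℕ) = xklmVal k l m i

namespace Cfg

variable {n k l m : ℕ} {x w : Equiv.Perm (Fin n)}

lemma smooth (h : Cfg n k l m x w) {a b : Fin n} (hu : Up x w a b) :
    Smooth (x * Equiv.swap a b) w := by
  refine ⟨hu.bruhatLE h.msp.1, ?_⟩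
  have := h.msp.2.2 _ ((swap_mem_R_iff h.msp.1 hu.1).2 hu)
  omega

lemma singular (h : Cfg n k l m x w) : invLen w < (R x w).ncard + invLen x := by
  have := h.msp.2.1
  omega

lemma valA (h : Cfg n k l m x w) {i : Fin n} (hi : (i : ℕ) < k) : (x i : ℕ) = k - 1 - i := by
  rw [h.val, xklmVal, if_pos hi]

lemma valB (h : Cfg n k l m x w) {i : Fin n} (hi : k ≤ (i : ℕ)) (hi' : (i : ℕ) < k + l) :
    (x i : ℕ) = 2 * k + l - 1 - i := by
  rw [h.val, xklmVal, if_neg (by omega), if_pos hi']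

lemma valC (h : Cfg n k l m x w) {i : Fin n} (hi : k + l ≤ (i : ℕ)) :
    (x i : ℕ) = 2 * (k + l) + m - 1 - i := by
  rw [h.val, xklmVal, if_neg (by omega), if_neg (by omega)]

/-- A description of all values of `x`. -/
lemma val_cases (h : Cfg n k l m x w) (i : Fin n) :
    ((i : ℕ) < k ∧ (x i : ℕ) = k - 1 - i) ∨
    (k ≤ (i : ℕ) ∧ (i : ℕ) < k + l ∧ (x i : ℕ) = 2 * k + l - 1 - i) ∨
    (k + l ≤ (i : ℕ) ∧ (i : ℕ) < n ∧ (x i : ℕ) = 2 * (k + l) + m - 1 - i) := by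
  by_cases h1 : (i : ℕ) < k
  · exact Or.inl ⟨h1, h.valA h1⟩
  · by_cases h2 : (i : ℕ) < k + l
    · exact Or.inr (Or.inl ⟨by omega, h2, h.valB (by omega) h2⟩)
    · exact Or.inr (Or.inr ⟨by omega, i.2, h.valC (by omega)⟩)

lemma noMidAB (h : Cfg n k l m x w) {a b : Fin n} (ha : (a : ℕ) < k) (hb : k ≤ (b : ℕ))
    (hb' : (b : ℕ) < k + l) : NoMid x a b := by
  intro c h1 h2 h3 h4
  rw [Fin.lt_def] at h1 h2 h3 h4
  have := h.val_cases a
  have := h.val_cases b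
  have := h.val_cases c
  have := h.sum
  omega

lemma swap_val_cases (y : Equiv.Perm (Fin n)) (s t c : Fin n) :
    ((c : ℕ) = s ∧ ((y * Equiv.swap s t) c : ℕ) = y t) ∨
    ((c : ℕ) = t ∧ ((y * Equiv.swap s t) c : ℕ) = y s) ∨
    ((c : ℕ) ≠ s ∧ (c : ℕ) ≠ t ∧ ((y * Equiv.swap s t) c : ℕ) = y c) := by
  by_cases h1 : c = s
  · subst h1; simp
  · by_cases h2 : c = t
    · subst h2; simp
    · right; right
      refine ⟨fun h => h1 (Fin.ext h), fun h => h2 (Fin.ext h), ?_⟩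
      simp [Equiv.swap_apply_of_ne_of_ne h1 h2]

lemma partnerAB (h : Cfg n k l m x w) {a b : Fin n} (ha : (a : ℕ) < k) (hb : k ≤ (b : ℕ))
    (hb' : (b : ℕ) < k + l) (hu : Up x w a b) :
    (∃ c : Fin n, k + l ≤ (c : ℕ) ∧ Up x w b c ∧ Blocked x w a b c) ∨
    (∃ a' b' : Fin n, (a' : ℕ) < k ∧ k ≤ (b' : ℕ) ∧ (b' : ℕ) < k + l ∧ a' ≠ a ∧ b' ≠ b ∧
      Up x w a' b' ∧ Clash x w a b a' b') ∨
    (∃ a' c' : Fin n, (a' : ℕ) < k ∧ k + l ≤ (c' : ℕ) ∧ a' ≠ a ∧ Up x w a' c' ∧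
      Clash x w a b a' c') := by
  have va := h.val_cases a
  have vb := h.val_cases b
  have hn := h.sum
  rcases exists_partner h.msp.1 h.singular hu (h.noMidAB ha hb hb') (h.smooth hu) with
    ⟨c, hca, hcb, hc⟩ | ⟨c, d, hca, hcb, hda, hdb, hcd, p, q, hpq⟩
  · have vc := h.val_cases c
    rcases hc with ⟨h1, h2, h3, h4, h5⟩ | ⟨h1, h2, h3, h4, h5⟩
    · refine Or.inl ⟨c, ?_, h3, h4, h5⟩
      rw [Fin.lt_def] at h1 h2
      omega
    · rw [Fin.lt_def] at h1 h2
      omega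
  · right
    have hcl : Clash x w a b c d := ⟨p, q, hpq⟩
    have vc := h.val_cases c
    have vd := h.val_cases d
    have hcd1 := Fin.lt_def.1 hcd.1
    have hcd2 := Fin.lt_def.1 hcd.2.1
    have hda' := Fin.val_ne_of_ne hda
    have hcb' := Fin.val_ne_of_ne hcb
    by_cases hd : (d : ℕ) < k + l
    · exact Or.inl ⟨c, d, by omega, by omega, hd, hca, hdb, hcd, hcl⟩
    · exact Or.inr ⟨c, d, by omega, by omega, hca, hcd, hcl⟩

lemma clash_imp_mem (h : Cfg n k l m x w) {a b a' b' b'' c : Fin n}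
    (ha : (a : ℕ) < k) (hb : k ≤ (b : ℕ)) (hb₁ : (b : ℕ) < k + l) (hab : Up x w a b)
    (ha' : (a' : ℕ) < k) (hb' : k ≤ (b' : ℕ)) (hb₁' : (b' : ℕ) < k + l) (hab' : Up x w a' b')
    (haa : a' ≠ a) (hbb : b' ≠ b) (hcl : Clash x w a b a' b')
    (hb'' : k ≤ (b'' : ℕ)) (hb₁'' : (b'' : ℕ) < k + l) (hc : k + l ≤ (c : ℕ))
    (hbc : Up x w b'' c) : b'' = b ∨ b'' = b' := by
  by_contra hcon
  push Not at hcon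
  obtain ⟨n1, n2⟩ := hcon
  have ne : ∀ {u v : Fin n}, (u : ℕ) ≠ v → u ≠ v := fun h h' => h (congrArg Fin.val h')
  have n1' := Fin.val_ne_of_ne n1
  have n2' := Fin.val_ne_of_ne n2
  have va := h.val_cases a
  have vb := h.val_cases b
  have va' := h.val_cases a'
  have vb' := h.val_cases b'
  have vb'' := h.val_cases b''
  have vc := h.val_cases c
  have hn := h.sum
  have hs := h.smooth hbc
  have u1 : Up (x * Equiv.swap b'' c) w a b := hab.mul_swap_of_sep hbc.1 hbc.2.1
    (ne (by omega)) (ne (by omega)) (ne (by omega)) (ne (by omega)) (by omega)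
  have u2 : Up (x * Equiv.swap b'' c) w a' b' := hab'.mul_swap_of_sep hbc.1 hbc.2.1
    (ne (by omega)) (ne (by omega)) (ne (by omega)) (ne (by omega)) (by omega)
  have hm : NoMid (x * Equiv.swap b'' c) a b := by
    intro d h1 h2 h3 h4
    rw [Fin.lt_def] at h1 h2 h3 h4
    have := swap_val_cases x b'' c d
    have := swap_val_cases x b'' c a
    have := swap_val_cases x b'' c b
    have := h.val_cases d
    omega
  obtain ⟨p, q, h1, h2, h3, h4, h5, h6, h7, h8, h9⟩ := hcl
  have s1 := swap_val_cases x b'' c a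
  have s2 := swap_val_cases x b'' c b
  have s3 := swap_val_cases x b'' c a'
  have s4 := swap_val_cases x b'' c b'
  have := hs.two_le (p := p) (q := q) u1 hm u2 haa (ne (by omega)) (ne (by omega)) hbb h1 h2
    (by omega) (by omega) h5 h6 (by omega) (by omega)
  have := dd_mul_swap_le x w hbc.1 hbc.2.1 p q
  omega

lemma clash_imp_blocked (h : Cfg n k l m x w) {a b a' b' c : Fin n}
    (ha : (a : ℕ) < k) (hb : k ≤ (b : ℕ)) (hb₁ : (b : ℕ) < k + l) (hab : Up x w a b)
    (ha' : (a' : ℕ) < k) (hb' : k ≤ (b' : ℕ)) (hb₁' : (b' : ℕ) < k + l) (hab' : Up x w a' b')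
    (haa : a' ≠ a) (hbb : b' ≠ b) (hcl : Clash x w a b a' b')
    (hc : k + l ≤ (c : ℕ)) (hbc : Up x w b c) : Blocked x w a b c := by
  have ne : ∀ {u v : Fin n}, (u : ℕ) ≠ v → u ≠ v := fun h h' => h (congrArg Fin.val h')
  have va := h.val_cases a
  have vb := h.val_cases b
  have va' := h.val_cases a'
  have vb' := h.val_cases b'
  have vc := h.val_cases c
  have hn := h.sum
  have hs := h.smooth hbc
  have hbb' := Fin.val_ne_of_ne hbb
  have u2 : Up (x * Equiv.swap b c) w a' b' := hab'.mul_swap_of_sep hbc.1 hbc.2.1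
    (ne (by omega)) (ne (by omega)) (ne (by omega)) (ne (by omega)) (by omega)
  have hm : NoMid (x * Equiv.swap b c) a' b' := by
    intro d h1 h2 h3 h4
    rw [Fin.lt_def] at h1 h2 h3 h4
    have := swap_val_cases x b c d
    have := swap_val_cases x b c a'
    have := swap_val_cases x b c b'
    have := h.val_cases d
    omega
  obtain ⟨p, q, h1, h2, h3, h4, h5, h6, h7, h8, h9⟩ := hcl
  have s1 := swap_val_cases x b c a
  have s2 := swap_val_cases x b c b
  have s3 := swap_val_cases x b c a'
  have s4 := swap_val_cases x b c b'
  have s5 := swap_val_cases x b c c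
  have hle := dd_mul_swap_le x w hbc.1 hbc.2.1 p q
  constructor
  · intro hbox
    have u1 := hab.mul_swap_left hbc.1 hbc.2.1 hbox
    have := hs.two_le (p := p) (q := q) u2 hm u1 (ne (by omega)) (ne (by omega)) (ne (by omega)) (ne (by omega))
      h5 h6 (by omega) (by omega) h1 h2 (by omega) (by omega)
    omega
  · intro hbox
    have u1 := hab.mul_swap_skip hbc.1 hbc.2.1 hbox
    have := hs.two_le (p := p) (q := q) u2 hm u1 (ne (by omega)) (ne (by omega)) (ne (by omega)) (ne (by omega))
      h5 h6 (by omega) (by omega) h1 (by omega) (by omega) (by omega)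
    omega

lemma blocked_imp_clash (h : Cfg n k l m x w) {a b a' b' c : Fin n}
    (ha : (a : ℕ) < k) (hb : k ≤ (b : ℕ)) (hb₁ : (b : ℕ) < k + l) (hab : Up x w a b)
    (ha' : (a' : ℕ) < k) (hb' : k ≤ (b' : ℕ)) (hb₁' : (b' : ℕ) < k + l) (hab' : Up x w a' b')
    (haa : a' ≠ a) (hbb : b' ≠ b) (hc : k + l ≤ (c : ℕ)) (hbc : Up x w b c)
    (hbl : Blocked x w a b c) : Clash x w a b a' b' := by
  by_contra hcl
  have ne : ∀ {u v : Fin n}, (u : ℕ) ≠ v → u ≠ v := fun h h' => h (congrArg Fin.val h')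
  have va := h.val_cases a
  have vb := h.val_cases b
  have va' := h.val_cases a'
  have vb' := h.val_cases b'
  have vc := h.val_cases c
  have hn := h.sum
  have hs := h.smooth hab'
  have hbb' := Fin.val_ne_of_ne hbb
  have haa' := Fin.val_ne_of_ne haa
  have u1 : Up (x * Equiv.swap a' b') w a b := by
    refine hab.mul_swap_of_two_le hab'.1 hab'.2.1 haa.symm (ne (by omega)) (ne (by omega))
      hbb.symm fun p q h1 h2 h3 h4 h5 h6 h7 h8 => ?_
    by_contra h9
    exact hcl ⟨p, q, h5, h6, h7, h8, h1, h2, h3, h4, by omega⟩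
  have u2 : Up (x * Equiv.swap a' b') w b c := hbc.mul_swap_of_sep hab'.1 hab'.2.1
    (ne (by omega)) (ne (by omega)) (ne (by omega)) (ne (by omega)) (by omega)
  have s1 := swap_val_cases x a' b' a
  have s2 := swap_val_cases x a' b' b
  have s3 := swap_val_cases x a' b' c
  have hm : NoMid (x * Equiv.swap a' b') b c := by
    intro d h1 h2 h3 h4
    rw [Fin.lt_def] at h1 h2 h3 h4
    have := swap_val_cases x a' b' d
    have := h.val_cases d
    omega
  have e1 : ((x * Equiv.swap a' b') a : ℕ) = x a := by omega
  have e2 : ((x * Equiv.swap a' b') b : ℕ) = x b := by omega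
  have e3 : ((x * Equiv.swap a' b') c : ℕ) = x c := by omega
  have := hs.posBox_or u1 u2 (Or.inr hm)
  rw [e1, e2, e3] at this
  rcases this with hh | hh
  · exact hbl.1 (posBox_of_mul_swap hab'.1 hab'.2.1 hh)
  · exact hbl.2 (posBox_of_mul_swap hab'.1 hab'.2.1 hh)

end Cfg

namespace Cfg

variable {n k l m : ℕ} {x w : Equiv.Perm (Fin n)}

lemma upAB_of_upAC (h : Cfg n k l m x w) {a b c : Fin n} (ha : (a : ℕ) < k) (hb : k ≤ (b : ℕ))
    (hb₁ : (b : ℕ) < k + l) (hc : k + l ≤ (c : ℕ)) (hac : Up x w a c) : Up x w a b := by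
  have va := h.val_cases a
  have vb := h.val_cases b
  have vc := h.val_cases c
  have hn := h.sum
  refine ⟨Fin.lt_def.2 (by omega), Fin.lt_def.2 (by omega), fun p q h1 h2 h3 h4 => ?_⟩
  exact hac.2.2 p q h1 (by omega) h3 (by omega)

lemma upBC_of_upAC (h : Cfg n k l m x w) {a b c : Fin n} (ha : (a : ℕ) < k) (hb : k ≤ (b : ℕ))
    (hb₁ : (b : ℕ) < k + l) (hc : k + l ≤ (c : ℕ)) (hac : Up x w a c) : Up x w b c := by
  have va := h.val_cases a
  have vb := h.val_cases b
  have vc := h.val_cases c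
  have hn := h.sum
  refine ⟨Fin.lt_def.2 (by omega), Fin.lt_def.2 (by omega), fun p q h1 h2 h3 h4 => ?_⟩
  exact hac.2.2 p q (by omega) h2 (by omega) h4

lemma not_blocked_of_upAC (h : Cfg n k l m x w) {a b c c' : Fin n} (ha : (a : ℕ) < k)
    (hb : k ≤ (b : ℕ)) (hb₁ : (b : ℕ) < k + l) (hc : k + l ≤ (c : ℕ)) (hc' : k + l ≤ (c' : ℕ))
    (hac : Up x w a c') : ¬ Blocked x w a b c := by
  have va := h.val_cases a
  have vb := h.val_cases b
  have vc := h.val_cases c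
  have vc' := h.val_cases c'
  have hn := h.sum
  rintro ⟨h1, h2⟩
  rcases le_total (c : ℕ) c' with hcc | hcc
  · exact h2 fun p q h3 h4 h5 h6 => hac.2.2 p q (by omega) (by omega) (by omega) (by omega)
  · exact h1 fun p q h3 h4 h5 h6 => hac.2.2 p q (by omega) (by omega) (by omega) (by omega)

lemma not_upAC (h : Cfg n k l m x w) {a c : Fin n} (ha : (a : ℕ) < k) (hc : k + l ≤ (c : ℕ)) :
    ¬ Up x w a c := by
  intro hac
  have ne : ∀ {u v : Fin n}, (u : ℕ) ≠ v → u ≠ v := fun h h' => h (congrArg Fin.val h')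
  have hn := h.sum
  have hl := h.hl
  have hm := h.hm
  obtain ⟨β, hβ⟩ : ∃ β : Fin n, (β : ℕ) = k + l - 1 := ⟨⟨k + l - 1, by omega⟩, rfl⟩
  have b1 : k ≤ (β : ℕ) := by omega
  have b2 : (β : ℕ) < k + l := by omega
  have haβ := h.upAB_of_upAC ha b1 b2 hc hac
  have hβc := h.upBC_of_upAC ha b1 b2 hc hac
  rcases h.partnerAB ha b1 b2 haβ with ⟨c₁, hc₁, -, hbl⟩ | ⟨a', b', ha', hb', hb₁', haa, hbb, hu, hcl⟩
    | ⟨a', c', ha', hc', haa, hu, hcl⟩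
  · exact h.not_blocked_of_upAC ha b1 b2 hc₁ hc hac hbl
  · exact h.not_blocked_of_upAC ha b1 b2 hc hc hac
      (h.clash_imp_blocked ha b1 b2 haβ ha' hb' hb₁' hu haa hbb hcl hc hβc)
  · have haβ' := h.upAB_of_upAC ha' b1 b2 hc' hu
    have hβc' := h.upBC_of_upAC ha' b1 b2 hc' hu
    have va := h.val_cases a
    have vb := h.val_cases β
    have va' := h.val_cases a'
    have vc' := h.val_cases c'
    have hs := h.smooth hβc'
    have hnb := h.not_blocked_of_upAC ha b1 b2 hc' hc hac
    obtain ⟨p, q, h1, h2, h3, h4, h5, h6, h7, h8, h9⟩ := hcl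
    have hle := dd_mul_swap_le x w hβc'.1 hβc'.2.1 p q
    have s1 := swap_val_cases x β c' a
    have s2 := swap_val_cases x β c' β
    have s3 := swap_val_cases x β c' a'
    have s4 := swap_val_cases x β c' c'
    have hcov : ∀ e : Fin n, (e : ℕ) < k → NoMid (x * Equiv.swap β c') e c' := by
      intro e he d g1 g2 g3 g4
      rw [Fin.lt_def] at g1 g2 g3 g4
      have := swap_val_cases x β c' d
      have := swap_val_cases x β c' e
      have := h.val_cases d
      have := h.val_cases e
      omega
    have side : ∀ e : Fin n, (e : ℕ) < k → Up x w e c' → PosBox (dd x w) e β (x β) (x c') ∧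
        PosBox (dd x w) β c' (x e) (x β) := by
      intro e he hec
      have := h.val_cases e
      exact ⟨fun p q g1 g2 g3 g4 => hec.2.2 p q (by omega) (by omega) (by omega) (by omega),
        fun p q g1 g2 g3 g4 => hec.2.2 p q (by omega) (by omega) (by omega) (by omega)⟩
    have hsd := side a' ha' hu
    rw [Blocked, not_and_or, not_not, not_not] at hnb
    rcases hnb with hbox | hbox
    · have u1 := haβ.mul_swap_left hβc'.1 hβc'.2.1 hbox
      have u2 := haβ'.mul_swap_skip hβc'.1 hβc'.2.1 hsd.2
      have := hs.two_le (p := p) (q := q) u2 (hcov a' ha') u1 haa.symm (ne (by omega))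
        (ne (by omega)) (ne (by omega)) h5 h6 (by omega) (by omega) h1 h2 (by omega) (by omega)
      omega
    · have u1 := haβ.mul_swap_skip hβc'.1 hβc'.2.1 hbox
      have u2 := haβ'.mul_swap_left hβc'.1 hβc'.2.1 hsd.1
      have := hs.two_le (p := p) (q := q) u1 (hcov a ha) u2 haa (ne (by omega))
        (ne (by omega)) (ne (by omega)) h1 (by omega) (by omega) (by omega)
        h5 (by omega) (by omega) (by omega)
      omega

end Cfg

/-- Co-rank: positions `≥ p` carrying values `< q`. -/
def crk {n : ℕ} (w : Equiv.Perm (Fin n)) (p q : ℕ) : ℕ :=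
  (Finset.univ.filter (fun i : Fin n => p ≤ (i : ℕ) ∧ (w i : ℕ) < q)).card

lemma crk_add {n : ℕ} (w : Equiv.Perm (Fin n)) (p q : ℕ) :
    crk w p q + (Finset.univ.filter (fun i : Fin n => (i : ℕ) < p)).card =
      rk w p q + (Finset.univ.filter (fun i : Fin n => (i : ℕ) < q)).card := by
  have h1 : (Finset.univ.filter (fun i : Fin n => (i : ℕ) < q)).card
      = (Finset.univ.filter (fun i : Fin n => (w i : ℕ) < q)).card := by
    symm
    refine Finset.card_bij (fun i _ => w i) ?_ ?_ ?_
    · intro i hi; simpa using hi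
    · intro i _ j _ hij; exact w.injective hij
    · intro j hj; exact ⟨w.symm j, by simpa using hj, by simp⟩
  have h2 := Finset.card_filter_add_card_filter_not (s := Finset.univ.filter
    (fun i : Fin n => (i : ℕ) < p)) (fun i => q ≤ (w i : ℕ))
  have h3 := Finset.card_filter_add_card_filter_not (s := Finset.univ.filter
    (fun i : Fin n => (w i : ℕ) < q)) (fun i => p ≤ (i : ℕ))
  rw [h1]
  simp only [Finset.filter_filter, not_le] at h2 h3
  have e1 : rk w p q = (Finset.univ.filter
    (fun i : Fin n => (i : ℕ) < p ∧ q ≤ (w i : ℕ))).card := rfl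
  have e2 : crk w p q = (Finset.univ.filter
    (fun i : Fin n => (w i : ℕ) < q ∧ p ≤ (i : ℕ))).card := by
    unfold crk; congr 1; ext i; simp [and_comm]
  have e3 : (Finset.univ.filter (fun i : Fin n => (w i : ℕ) < q ∧ (i : ℕ) < p)).card =
      (Finset.univ.filter (fun i : Fin n => (i : ℕ) < p ∧ (w i : ℕ) < q)).card := by
    congr 1; ext i; simp [and_comm]
  omega

lemma crk_sub_crk {n : ℕ} (y w : Equiv.Perm (Fin n)) (p q : ℕ) :
    (crk w p q : ℤ) - crk y p q = dd y w p q := by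
  have h1 := crk_add w p q
  have h2 := crk_add y p q
  unfold dd
  omega

lemma rk_inv {n : ℕ} (w : Equiv.Perm (Fin n)) (p q : ℕ) : rk w⁻¹ p q = crk w q p := by
  unfold rk crk
  refine Finset.card_bij (fun i _ => w⁻¹ i) ?_ ?_ ?_
  · intro i hi; simpa [and_comm] using hi
  · intro i _ j _ hij; exact w⁻¹.injective hij
  · intro j hj; exact ⟨w j, by simpa [and_comm] using hj, by simp⟩

lemma dd_inv {n : ℕ} (y w : Equiv.Perm (Fin n)) (p q : ℕ) :
    dd y⁻¹ w⁻¹ p q = dd y w q p := by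
  rw [← crk_sub_crk y w, dd, rk_inv, rk_inv]

/-- Conjugation by the order-reversing permutation. -/
def revConj {n : ℕ} (w : Equiv.Perm (Fin n)) : Equiv.Perm (Fin n) :=
  Fin.revPerm * w * Fin.revPerm

lemma revConj_apply {n : ℕ} (w : Equiv.Perm (Fin n)) (i : Fin n) :
    revConj w i = Fin.rev (w (Fin.rev i)) := rfl

lemma revConj_revConj {n : ℕ} (w : Equiv.Perm (Fin n)) : revConj (revConj w) = w := by
  ext i; simp [revConj_apply]

lemma rk_revConj {n : ℕ} (w : Equiv.Perm (Fin n)) (p q : ℕ) :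
    rk (revConj w) p q = crk w (n - p) (n - q) := by
  unfold rk crk
  refine Finset.card_bij (fun i _ => Fin.rev i) ?_ ?_ ?_
  · intro i hi
    rw [Finset.mem_filter] at hi ⊢
    simp only [Finset.mem_univ, true_and, revConj_apply, Fin.val_rev] at hi ⊢
    have := (w (Fin.rev i)).2
    omega
  · intro i _ j _ hij; exact Fin.rev_injective hij
  · intro j hj
    refine ⟨Fin.rev j, ?_, by simp⟩
    rw [Finset.mem_filter] at hj ⊢
    simp only [Finset.mem_univ, true_and, revConj_apply, Fin.val_rev,
      Fin.rev_rev] at hj ⊢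
    have := (w j).2
    have := j.2
    omega

lemma dd_revConj {n : ℕ} (y w : Equiv.Perm (Fin n)) (p q : ℕ) :
    dd (revConj y) (revConj w) p q = dd y w (n - p) (n - q) := by
  rw [← crk_sub_crk y w, dd, rk_revConj, rk_revConj]

lemma bruhatLE_inv {n : ℕ} {y w : Equiv.Perm (Fin n)} (h : bruhatLE y w) :
    bruhatLE y⁻¹ w⁻¹ := by
  rw [bruhatLE_iff] at h ⊢
  intro p q; rw [dd_inv]; exact h q p

lemma bruhatLE_revConj {n : ℕ} {y w : Equiv.Perm (Fin n)} (h : bruhatLE y w) :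
    bruhatLE (revConj y) (revConj w) := by
  rw [bruhatLE_iff] at h ⊢
  intro p q; rw [dd_revConj]; exact h _ _

lemma invLen_inv {n : ℕ} (y : Equiv.Perm (Fin n)) : invLen y⁻¹ = invLen y := by
  unfold invLen
  refine Finset.card_bij (fun p _ => (y⁻¹ p.2, y⁻¹ p.1)) ?_ ?_ ?_
  · intro p hp; simpa [and_comm] using hp
  · rintro ⟨i, j⟩ _ ⟨i', j'⟩ _ h
    simpa [and_comm] using h
  · rintro ⟨i, j⟩ h
    exact ⟨(y j, y i), by simpa [and_comm] using h, by simp⟩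

lemma invLen_revConj {n : ℕ} (y : Equiv.Perm (Fin n)) : invLen (revConj y) = invLen y := by
  unfold invLen
  refine Finset.card_bij (fun p _ => (Fin.rev p.2, Fin.rev p.1)) ?_ ?_ ?_
  · intro p hp
    simpa [revConj_apply, Fin.rev_lt_rev] using hp
  · rintro ⟨i, j⟩ _ ⟨i', j'⟩ _ h
    simpa [and_comm] using h
  · rintro ⟨i, j⟩ h
    exact ⟨(Fin.rev j, Fin.rev i), by simpa [revConj_apply, Fin.rev_lt_rev] using h, by simp⟩

lemma conj_mem_transpositions {n : ℕ} (g t : Equiv.Perm (Fin n)) (ht : t ∈ transpositions n) :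
    g * t * g⁻¹ ∈ transpositions n := by
  obtain ⟨a, b, hab, rfl⟩ := ht
  refine ⟨g a, g b, fun h => hab (g.injective h), ?_⟩
  rw [Equiv.mul_swap_eq_swap_mul, mul_assoc, mul_inv_cancel, mul_one]

/-- Transport of `R` along an involution `F` that acts on right multiplication by transpositions
through conjugation by `g y`. -/
lemma R_transport {n : ℕ} (F : Equiv.Perm (Fin n) → Equiv.Perm (Fin n))
    (hF : ∀ y, F (F y) = y) (hlen : ∀ y, invLen (F y) = invLen y)
    (hle : ∀ y w, bruhatLE y w → bruhatLE (F y) (F w))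
    (g : Equiv.Perm (Fin n) → Equiv.Perm (Fin n))
    (hg : ∀ y, ∀ t ∈ transpositions n, F (y * t) = F y * (g y * t * (g y)⁻¹))
    (y w : Equiv.Perm (Fin n)) :
    R (F y) (F w) = (fun t => g y * t * (g y)⁻¹) '' R y w := by
  have hle' : ∀ y w, bruhatLE (F y) (F w) → bruhatLE y w := fun y w h => by
    have := hle _ _ h
    rwa [hF, hF] at this
  ext s
  constructor
  · rintro ⟨h1, h2, h3⟩
    have h4 : (g y)⁻¹ * s * g y ∈ transpositions n := by
      simpa using conj_mem_transpositions (g y)⁻¹ s h1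
    have h5 : g y * ((g y)⁻¹ * s * g y) * (g y)⁻¹ = s := by group
    have h6 := hg y _ h4
    rw [h5] at h6
    refine ⟨(g y)⁻¹ * s * g y, ⟨h4, ?_, ?_⟩, h5⟩
    · rw [← hlen y, ← hlen (y * _), h6]; exact h2
    · rw [← h6] at h3; exact hle' _ _ h3
  · rintro ⟨t, ⟨h1, h2, h3⟩, rfl⟩
    refine ⟨conj_mem_transpositions _ _ h1, ?_, ?_⟩
    · rw [← hg y t h1, hlen, hlen]; exact h2
    · simp only
      rw [← hg y t h1]; exact hle _ _ h3

lemma MSP_transport {n : ℕ} (F : Equiv.Perm (Fin n) → Equiv.Perm (Fin n))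
    (hF : ∀ y, F (F y) = y) (hlen : ∀ y, invLen (F y) = invLen y)
    (hle : ∀ y w, bruhatLE y w → bruhatLE (F y) (F w))
    (g : Equiv.Perm (Fin n) → Equiv.Perm (Fin n))
    (hg : ∀ y, ∀ t ∈ transpositions n, F (y * t) = F y * (g y * t * (g y)⁻¹))
    {x w : Equiv.Perm (Fin n)} (h : MSP x w) (hd : Delta x w = Set.univ) :
    MSP (F x) (F w) ∧ Delta (F x) (F w) = Set.univ := by
  have hR := R_transport F hF hlen hle g hg
  have hcard : ∀ y, (R (F y) (F w)).ncard = (R y w).ncard := fun y => by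
    rw [hR, Set.ncard_image_of_injective]
    intro s t hst
    simpa using hst
  refine ⟨⟨hle _ _ h.1, ?_, ?_⟩, ?_⟩
  · rw [hcard, hlen, hlen]; exact h.2.1
  · rw [hR]
    rintro _ ⟨t, ht, rfl⟩
    simp only
    rw [← hg x t ht.1, hcard, hlen, hlen]
    exact h.2.2 t ht
  · rw [Set.eq_univ_iff_forall] at hd ⊢
    intro i
    obtain ⟨j, hj⟩ := hd ((g x)⁻¹ i)
    refine ⟨g x j, ?_⟩
    rw [hR]
    refine ⟨_, hj, ?_⟩
    simp only
    rw [Equiv.mul_swap_eq_swap_mul, mul_assoc, mul_inv_cancel, mul_one]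
    simp

namespace Cfg

variable {n k l m : ℕ} {x w : Equiv.Perm (Fin n)}

lemma x_inv (h : Cfg n k l m x w) : x⁻¹ = x := by
  ext i
  rw [Equiv.Perm.inv_def]
  have h1 := h.val_cases (x.symm i)
  have h2 := h.val_cases i
  rw [Equiv.apply_symm_apply] at h1
  have := h.sum
  omega

lemma inv (h : Cfg n k l m x w) : Cfg n k l m x w⁻¹ := by
  have key := MSP_transport (fun y : Equiv.Perm (Fin n) => y⁻¹) inv_inv invLen_inv
    (fun _ _ => bruhatLE_inv) id (by
      rintro y t ⟨a, b, -, rfl⟩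
      simp [mul_assoc]) h.msp h.delta
  simp only [h.x_inv] at key
  exact ⟨key.1, key.2, h.hk, h.hl, h.hm, h.sum, h.val⟩

lemma rev (h : Cfg n k l m x w) : Cfg n m l k (revConj x) (revConj w) := by
  have hr : (Fin.revPerm : Equiv.Perm (Fin n))⁻¹ = Fin.revPerm := rfl
  have hr' : (Fin.revPerm : Equiv.Perm (Fin n)) * Fin.revPerm = 1 := by
    ext i; simp
  have key := MSP_transport revConj revConj_revConj invLen_revConj
    (fun _ _ => bruhatLE_revConj) (fun _ => Fin.revPerm) (by
      intro y t _
      ext i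
      simp [revConj, Equiv.Perm.mul_apply, hr]) h.msp h.delta
  refine ⟨key.1, key.2, h.hm, h.hl, h.hk, by have := h.sum; omega, fun i => ?_⟩
  have h1 := h.val_cases (Fin.rev i)
  have h2 := h.sum
  have h3 : (revConj x i : ℕ) = n - (x (Fin.rev i) + 1) := by
    rw [revConj_apply, Fin.val_rev]
  have h4 : (Fin.rev i : ℕ) = n - (i + 1) := Fin.val_rev i
  have h5 := i.2
  unfold xklmVal
  split_ifs <;> omega

end Cfg

lemma posBox_revConj {n : ℕ} (y w : Equiv.Perm (Fin n)) {p₁ p₂ q₁ q₂ : ℕ} (hp : p₂ < n)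
    (hq : q₂ < n) : PosBox (dd (revConj y) (revConj w)) (n - (p₂ + 1)) (n - (p₁ + 1))
      (n - (q₂ + 1)) (n - (q₁ + 1)) ↔ PosBox (dd y w) p₁ p₂ q₁ q₂ := by
  constructor
  · intro h p q h1 h2 h3 h4
    have := h (n - p) (n - q) (by omega) (by omega) (by omega) (by omega)
    rw [dd_revConj] at this
    convert this using 2 <;> omega
  · intro h p q h1 h2 h3 h4
    rw [dd_revConj]
    exact h _ _ (by omega) (by omega) (by omega) (by omega)

lemma val_revConj_rev {n : ℕ} (y : Equiv.Perm (Fin n)) (i : Fin n) :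
    (revConj y (Fin.rev i) : ℕ) = n - (y i + 1) := by
  rw [revConj_apply, Fin.rev_rev, Fin.val_rev]

lemma up_revConj {n : ℕ} (y w : Equiv.Perm (Fin n)) (i j : Fin n) :
    Up (revConj y) (revConj w) (Fin.rev j) (Fin.rev i) ↔ Up y w i j := by
  unfold Up
  rw [val_revConj_rev, val_revConj_rev, Fin.val_rev, Fin.val_rev,
    posBox_revConj y w j.2 (y j).2, Fin.rev_lt_rev, revConj_apply, revConj_apply, Fin.rev_rev,
    Fin.rev_rev, Fin.rev_lt_rev]

lemma blocked_revConj {n : ℕ} (y w : Equiv.Perm (Fin n)) (a b c : Fin n) :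
    Blocked (revConj y) (revConj w) (Fin.rev c) (Fin.rev b) (Fin.rev a) ↔ Blocked y w a b c := by
  unfold Blocked
  rw [val_revConj_rev, val_revConj_rev, val_revConj_rev, Fin.val_rev, Fin.val_rev, Fin.val_rev,
    posBox_revConj y w c.2 (y b).2, posBox_revConj y w b.2 (y c).2, and_comm]

lemma Clash.revConj {n : ℕ} {y w : Equiv.Perm (Fin n)} {a b c d : Fin n}
    (h : Clash y w a b c d) :
    Clash (revConj y) (revConj w) (Fin.rev b) (Fin.rev a) (Fin.rev d) (Fin.rev c) := by
  obtain ⟨p, q, h1, h2, h3, h4, h5, h6, h7, h8, h9⟩ := h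
  have := b.2
  have := (y b).2
  have := d.2
  have := (y d).2
  unfold Clash
  simp only [val_revConj_rev, Fin.val_rev]
  refine ⟨n - p, n - q, by omega, by omega, by omega, by omega, by omega, by omega, by omega,
    by omega, ?_⟩
  have e1 : n - (n - p) = p := by omega
  have e2 : n - (n - q) = q := by omega
  rw [dd_revConj, e1, e2]
  exact h9

lemma clash_revConj {n : ℕ} (y w : Equiv.Perm (Fin n)) (a b c d : Fin n) :
    Clash (revConj y) (revConj w) (Fin.rev b) (Fin.rev a) (Fin.rev d) (Fin.rev c) ↔
      Clash y w a b c d := by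
  refine ⟨fun h => ?_, fun h => h.revConj⟩
  have := h.revConj
  simpa only [revConj_revConj, Fin.rev_rev] using this

namespace Cfg

variable {n k l m : ℕ} {x w : Equiv.Perm (Fin n)}

lemma nonneg (h : Cfg n k l m x w) (p q : ℕ) : 0 ≤ dd x w p q := (bruhatLE_iff x w).1 h.msp.1 p q

lemma dd_inv' (h : Cfg n k l m x w) (p q : ℕ) : dd x w⁻¹ p q = dd x w q p := by
  have := dd_inv x w p q
  rwa [h.x_inv] at this

lemma step (_h : Cfg n k l m x w) (p : Fin n) (q : ℕ) :
    dd x w (p + 1) q = dd x w p q + (if q ≤ (w p : ℕ) then 1 else 0)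
      - (if q ≤ (x p : ℕ) then 1 else 0) := by
  unfold dd
  rw [rk_succ_left, rk_succ_left]
  push_cast
  ring

lemma stepQ (h : Cfg n k l m x w) (p : ℕ) (q : Fin n) :
    dd x w p (q + 1) = dd x w p q + (if p ≤ (w⁻¹ q : ℕ) then 1 else 0)
      - (if p ≤ (x q : ℕ) then 1 else 0) := by
  have := h.inv.step q p
  rwa [h.dd_inv', h.dd_inv'] at this

lemma dd_zero_left (_h : Cfg n k l m x w) (q : ℕ) : dd x w 0 q = 0 := by
  simp [dd, rk_zero_left]

lemma mono_up (h : Cfg n k l m x w) {p p' q : ℕ} (hp : p ≤ p') (hn : p' ≤ n)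
    (hr : ∀ r : Fin n, p ≤ r → (r : ℕ) < p' → (x r : ℕ) < q) : dd x w p q ≤ dd x w p' q := by
  induction p', hp using Nat.le_induction with
  | base => exact le_rfl
  | succ s hs ih =>
    refine (ih (by omega) fun r h1 h2 => hr r h1 (by omega)).trans ?_
    have h1 := hr ⟨s, by omega⟩ hs (by simp)
    have h2 := h.step ⟨s, by omega⟩ q
    rw [if_neg (c := q ≤ (x _ : ℕ)) (by omega)] at h2
    simp only at h2
    rw [h2]
    split_ifs <;> omega

lemma mono_down (h : Cfg n k l m x w) {p p' q : ℕ} (hp : p ≤ p') (hn : p' ≤ n)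
    (hr : ∀ r : Fin n, p ≤ r → (r : ℕ) < p' → q ≤ (x r : ℕ)) : dd x w p' q ≤ dd x w p q := by
  induction p', hp using Nat.le_induction with
  | base => exact le_rfl
  | succ s hs ih =>
    refine le_trans ?_ (ih (by omega) fun r h1 h2 => hr r h1 (by omega))
    have h1 := hr ⟨s, by omega⟩ hs (by simp)
    have h2 := h.step ⟨s, by omega⟩ q
    rw [if_pos (c := q ≤ (x _ : ℕ)) (by omega)] at h2
    simp only at h2
    rw [h2]
    split_ifs <;> omega

lemma mono_upQ (h : Cfg n k l m x w) {p q q' : ℕ} (hq : q ≤ q') (hn : q' ≤ n)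
    (hr : ∀ r : Fin n, q ≤ r → (r : ℕ) < q' → (x r : ℕ) < p) : dd x w p q ≤ dd x w p q' := by
  have := h.inv.mono_up hq hn hr
  rwa [h.dd_inv', h.dd_inv'] at this

lemma mono_downQ (h : Cfg n k l m x w) {p q q' : ℕ} (hq : q ≤ q') (hn : q' ≤ n)
    (hr : ∀ r : Fin n, q ≤ r → (r : ℕ) < q' → p ≤ (x r : ℕ)) : dd x w p q' ≤ dd x w p q := by
  have := h.inv.mono_down hq hn hr
  rwa [h.dd_inv', h.dd_inv'] at this

/-- An edge between the first and the second block. -/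
def EA {n : ℕ} (k l : ℕ) (x w : Equiv.Perm (Fin n)) (a b : Fin n) : Prop :=
  (a : ℕ) < k ∧ k ≤ (b : ℕ) ∧ (b : ℕ) < k + l ∧ Up x w a b

/-- An edge between the second and the third block. -/
def EC {n : ℕ} (k l : ℕ) (x w : Equiv.Perm (Fin n)) (b c : Fin n) : Prop :=
  k ≤ (b : ℕ) ∧ (b : ℕ) < k + l ∧ k + l ≤ (c : ℕ) ∧ Up x w b c

lemma EA_rev (h : Cfg n k l m x w) (b c : Fin n) :
    EA m l (revConj x) (revConj w) (Fin.rev c) (Fin.rev b) ↔ EC k l x w b c := by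
  unfold EA EC
  rw [up_revConj, Fin.val_rev, Fin.val_rev]
  have := h.sum
  constructor
  · rintro ⟨h1, h2, h3, h4⟩; exact ⟨by omega, by omega, by omega, h4⟩
  · rintro ⟨h1, h2, h3, h4⟩; exact ⟨by omega, by omega, by omega, h4⟩

lemma EC_rev (h : Cfg n k l m x w) (a b : Fin n) :
    EC m l (revConj x) (revConj w) (Fin.rev b) (Fin.rev a) ↔ EA k l x w a b := by
  unfold EA EC
  rw [up_revConj, Fin.val_rev, Fin.val_rev]
  have := h.sum
  constructor
  · rintro ⟨h1, h2, h3, h4⟩; exact ⟨by omega, by omega, by omega, h4⟩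
  · rintro ⟨h1, h2, h3, h4⟩; exact ⟨by omega, by omega, by omega, h4⟩

lemma EA.partner {a b : Fin n} (e : EA k l x w a b) (h : Cfg n k l m x w) :
    (∃ c, EC k l x w b c ∧ Blocked x w a b c) ∨
    ∃ a' b', EA k l x w a' b' ∧ a' ≠ a ∧ b' ≠ b ∧ Clash x w a b a' b' := by
  rcases h.partnerAB e.1 e.2.1 e.2.2.1 e.2.2.2 with ⟨c, h1, h2, h3⟩ |
    ⟨a', b', h1, h2, h3, h4, h5, h6, h7⟩ | ⟨a', c', h1, h2, -, h4, -⟩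
  · exact Or.inl ⟨c, ⟨e.2.1, e.2.2.1, h1, h2⟩, h3⟩
  · exact Or.inr ⟨a', b', ⟨h1, h2, h3, h6⟩, h4, h5, h7⟩
  · exact absurd h4 (h.not_upAC h1 h2)

lemma EC.partner {b c : Fin n} (e : EC k l x w b c) (h : Cfg n k l m x w) :
    (∃ a, EA k l x w a b ∧ Blocked x w a b c) ∨
    ∃ b' c', EC k l x w b' c' ∧ b' ≠ b ∧ c' ≠ c ∧ Clash x w b c b' c' := by
  rcases ((h.EA_rev b c).2 e).partner h.rev with ⟨a, h1, h2⟩ | ⟨c', b', h1, h2, h3, h4⟩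
  · obtain ⟨a, rfl⟩ := Fin.rev_surjective a
    exact Or.inl ⟨a, (h.EC_rev a b).1 h1, (blocked_revConj _ _ _ _ _).1 h2⟩
  · obtain ⟨c', rfl⟩ := Fin.rev_surjective c'
    obtain ⟨b', rfl⟩ := Fin.rev_surjective b'
    exact Or.inr ⟨b', c', (h.EA_rev b' c').1 h1, fun h' => h3 (congrArg _ h'),
      fun h' => h2 (congrArg _ h'), (clash_revConj _ _ _ _ _ _).1 h4⟩

lemma EA.clash_mem {a b a' b' b'' c : Fin n} (e : EA k l x w a b) (h : Cfg n k l m x w)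
    (e' : EA k l x w a' b') (ha : a' ≠ a) (hb : b' ≠ b) (hc : Clash x w a b a' b')
    (f : EC k l x w b'' c) : b'' = b ∨ b'' = b' :=
  h.clash_imp_mem e.1 e.2.1 e.2.2.1 e.2.2.2 e'.1 e'.2.1 e'.2.2.1 e'.2.2.2 ha hb hc f.1 f.2.1
    f.2.2.1 f.2.2.2

lemma EC.clash_mem {b c b' c' a b'' : Fin n} (e : EC k l x w b c) (h : Cfg n k l m x w)
    (e' : EC k l x w b' c') (hb : b' ≠ b) (hc : c' ≠ c) (hcl : Clash x w b c b' c')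
    (f : EA k l x w a b'') : b'' = b ∨ b'' = b' := by
  have := ((h.EA_rev b c).2 e).clash_mem h.rev ((h.EA_rev b' c').2 e')
    (fun h' => hc (Fin.rev_injective h')) (fun h' => hb (Fin.rev_injective h'))
    ((clash_revConj _ _ _ _ _ _).2 hcl) ((h.EC_rev a b'').2 f)
  exact this.imp (fun h' => Fin.rev_injective h') (fun h' => Fin.rev_injective h')

lemma EA.clash_blocked {a b a' b' c : Fin n} (e : EA k l x w a b) (h : Cfg n k l m x w)
    (e' : EA k l x w a' b') (ha : a' ≠ a) (hb : b' ≠ b) (hc : Clash x w a b a' b')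
    (f : EC k l x w b c) : Blocked x w a b c :=
  h.clash_imp_blocked e.1 e.2.1 e.2.2.1 e.2.2.2 e'.1 e'.2.1 e'.2.2.1 e'.2.2.2 ha hb hc
    f.2.2.1 f.2.2.2

lemma EC.clash_blocked {b c b' c' a : Fin n} (e : EC k l x w b c) (h : Cfg n k l m x w)
    (e' : EC k l x w b' c') (hb : b' ≠ b) (hc : c' ≠ c) (hcl : Clash x w b c b' c')
    (f : EA k l x w a b) : Blocked x w a b c :=
  (blocked_revConj _ _ _ _ _).1 <| ((h.EA_rev b c).2 e).clash_blocked h.rev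
    ((h.EA_rev b' c').2 e') (fun h' => hc (Fin.rev_injective h'))
    (fun h' => hb (Fin.rev_injective h')) ((clash_revConj _ _ _ _ _ _).2 hcl)
    ((h.EC_rev a b).2 f)

lemma EA.blocked_clash {a b a' b' c : Fin n} (e : EA k l x w a b) (h : Cfg n k l m x w)
    (e' : EA k l x w a' b') (ha : a' ≠ a) (hb : b' ≠ b) (f : EC k l x w b c)
    (hbl : Blocked x w a b c) : Clash x w a b a' b' :=
  h.blocked_imp_clash e.1 e.2.1 e.2.2.1 e.2.2.2 e'.1 e'.2.1 e'.2.2.1 e'.2.2.2 ha hb f.2.2.1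
    f.2.2.2 hbl

lemma exists_up (h : Cfg n k l m x w) (i : Fin n) : ∃ j, UpS x w i j := by
  have : i ∈ Delta x w := by rw [h.delta]; trivial
  obtain ⟨j, hj⟩ := this
  obtain ⟨a, b, hab, hs⟩ := hj.1
  have hij : i ≠ j := by
    rintro rfl
    rw [Equiv.swap_self] at hs
    have := congrArg (fun e : Equiv.Perm (Fin n) => e a) hs
    simp only [Equiv.refl_apply, Equiv.swap_apply_left] at this
    exact hab this
  rcases lt_or_gt_of_ne hij with h' | h'
  · exact ⟨j, Or.inl ((swap_mem_R_iff h.msp.1 h').1 hj)⟩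
  · rw [Equiv.swap_comm] at hj
    exact ⟨j, Or.inr ((swap_mem_R_iff h.msp.1 h').1 hj)⟩

lemma EA_or_EC_of_up (h : Cfg n k l m x w) {i j : Fin n} (hu : Up x w i j) :
    EA k l x w i j ∨ EC k l x w i j := by
  have vi := h.val_cases i
  have vj := h.val_cases j
  have h1 := Fin.lt_def.1 hu.1
  have h2 := Fin.lt_def.1 hu.2.1
  have := h.sum
  by_cases hi : (i : ℕ) < k
  · by_cases hj : (j : ℕ) < k + l
    · exact Or.inl ⟨hi, by omega, hj, hu⟩
    · exact absurd hu (h.not_upAC hi (by omega))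
  · exact Or.inr ⟨by omega, by omega, by omega, hu⟩

lemma exists_EA (h : Cfg n k l m x w) {a : Fin n} (ha : (a : ℕ) < k) : ∃ b, EA k l x w a b := by
  obtain ⟨j, hj | hj⟩ := h.exists_up a <;> rcases h.EA_or_EC_of_up hj with e | e
  · exact ⟨j, e⟩
  · exact absurd e.1 (by omega)
  · exact absurd e.2.1 (by omega)
  · exact absurd e.2.2.1 (by omega)

lemma exists_EC (h : Cfg n k l m x w) {c : Fin n} (hc : k + l ≤ (c : ℕ)) :
    ∃ b, EC k l x w b c := by
  have := h.hl
  obtain ⟨j, hj | hj⟩ := h.exists_up c <;> rcases h.EA_or_EC_of_up hj with e | e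
  · exact absurd e.1 (by omega)
  · exact absurd e.2.1 (by omega)
  · exact absurd e.2.2.1 (by omega)
  · exact ⟨j, e⟩

lemma exists_EA_or_EC (h : Cfg n k l m x w) {b : Fin n} (hb : k ≤ (b : ℕ))
    (hb' : (b : ℕ) < k + l) : (∃ a, EA k l x w a b) ∨ ∃ c, EC k l x w b c := by
  obtain ⟨j, hj | hj⟩ := h.exists_up b <;> rcases h.EA_or_EC_of_up hj with e | e
  · exact absurd e.1 (by omega)
  · exact Or.inr ⟨j, e⟩
  · exact Or.inl ⟨j, e⟩
  · exact absurd e.2.2.1 (by omega)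

/-- Four-corner criterion for edges between the first and the second block. -/
lemma EA_of_corners (h : Cfg n k l m x w) {a b : Fin n} (ha : (a : ℕ) < k) (hb : k ≤ (b : ℕ))
    (hb' : (b : ℕ) < k + l) (h1 : 1 ≤ dd x w (a + 1) (x a + 1)) (h2 : 1 ≤ dd x w (a + 1) (x b))
    (h3 : 1 ≤ dd x w b (x a + 1)) (h4 : 1 ≤ dd x w b (x b)) : EA k l x w a b := by
  have va := h.val_cases a
  have vb := h.val_cases b
  have hn := h.sum
  refine ⟨ha, hb, hb', Fin.lt_def.2 (by omega), Fin.lt_def.2 (by omega), ?_⟩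
  have col : ∀ p : ℕ, (p = (a : ℕ) + 1 ∨ p = (b : ℕ)) → ∀ q : ℕ, (x a : ℕ) < q → q ≤ x b → 1 ≤ dd x w p q := by
    intro p hp q hq1 hq2
    have c1 : 1 ≤ dd x w p (x a + 1) := by rcases hp with rfl | rfl <;> assumption
    have c2 : 1 ≤ dd x w p (x b) := by rcases hp with rfl | rfl <;> assumption
    by_cases hqk : q ≤ k
    · refine c1.trans (h.mono_upQ (by omega) (by omega) fun r hr1 hr2 => ?_)
      have := h.val_cases r
      omega
    · refine c2.trans (h.mono_downQ (by omega) (by omega) fun r hr1 hr2 => ?_)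
      have := h.val_cases r
      omega
  intro p q h5 h6 h7 h8
  by_cases hpk : p ≤ k
  · refine (col (a + 1) (Or.inl rfl) q h7 h8).trans
      (h.mono_up (by omega) (by omega) fun r hr1 hr2 => ?_)
    have := h.val_cases r
    omega
  · refine (col b (Or.inr rfl) q h7 h8).trans
      (h.mono_down (by omega) (by omega) fun r hr1 hr2 => ?_)
    have := h.val_cases r
    omega

/-- Every box of an edge is positive. -/
lemma EA.one_le {a b : Fin n} (e : EA k l x w a b) {p q : ℕ} (h1 : (a : ℕ) < p) (h2 : p ≤ b)
    (h3 : (x a : ℕ) < q) (h4 : q ≤ x b) : 1 ≤ dd x w p q := e.2.2.2.2.2 p q h1 h2 h3 h4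

lemma EC.one_le {a b : Fin n} (e : EC k l x w a b) {p q : ℕ} (h1 : (a : ℕ) < p) (h2 : p ≤ b)
    (h3 : (x a : ℕ) < q) (h4 : q ≤ x b) : 1 ≤ dd x w p q := e.2.2.2.2.2 p q h1 h2 h3 h4

lemma freeA (h : Cfg n k l m x w) {a : Fin n} (ha : (a : ℕ) < k) :
    1 ≤ dd x w (a + 1) (x a + 1) := by
  obtain ⟨b, e⟩ := h.exists_EA ha
  have h1 := Fin.lt_def.1 e.2.2.2.1
  have h2 := Fin.lt_def.1 e.2.2.2.2.1
  exact e.one_le (by omega) (by omega) (by omega) (by omega)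

lemma freeC (h : Cfg n k l m x w) {c : Fin n} (hc : k + l ≤ (c : ℕ)) :
    1 ≤ dd x w c (x c) := by
  obtain ⟨b, e⟩ := h.exists_EC hc
  have h1 := Fin.lt_def.1 e.2.2.2.1
  have h2 := Fin.lt_def.1 e.2.2.2.2.1
  exact e.one_le (by omega) (by omega) (by omega) (by omega)

end Cfg

namespace Cfg

variable {n k l m : ℕ} {x w : Equiv.Perm (Fin n)}

lemma le_apply_of_blocked (h : Cfg n k l m x w) {a b c : Fin n} (ha : (a : ℕ) = k - 1)
    (hb : (b : ℕ) = k) (f : EC k l x w b c) (hbl : Blocked x w a b c) : (x c : ℕ) ≤ w b := by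
  have va := h.val_cases a
  have vb := h.val_cases b
  have vc := h.val_cases c
  have hn := h.sum
  have hk := h.hk
  have f1 := f.1
  have f2 := f.2.1
  have f3 := f.2.2.1
  have h1 := hbl.1
  unfold PosBox at h1
  push Not at h1
  obtain ⟨p, q, h1, h2, h3, h4, h5⟩ := h1
  have hp : p = k := by omega
  subst hp
  have h6 : dd x w p (x c) ≤ dd x w p q := by
    refine h.mono_downQ h4 (by omega) fun r hr1 hr2 => ?_
    have := h.val_cases r
    omega
  have h7 : 1 ≤ dd x w (b + 1) (x c) := f.one_le (by omega) (by omega) (by omega) le_rfl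
  have h8 := h.step b (x c)
  rw [hb] at h7 h8
  by_contra hcon
  rw [if_neg hcon] at h8
  split_ifs at h8 <;> omega

lemma two_le_l (h : Cfg n k l m x w) : 2 ≤ l := by
  by_contra hl
  have hl1 : l = 1 := by have := h.hl; omega
  subst hl1
  have hn := h.sum
  have hk := h.hk
  have hm := h.hm
  obtain ⟨α, hα⟩ : ∃ α : Fin n, (α : ℕ) = k - 1 := ⟨⟨k - 1, by omega⟩, rfl⟩
  obtain ⟨γ, hγ⟩ : ∃ γ : Fin n, (γ : ℕ) = k + 1 := ⟨⟨k + 1, by omega⟩, rfl⟩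
  obtain ⟨b, e⟩ := h.exists_EA (a := α) (by omega)
  obtain ⟨b', f⟩ := h.exists_EC (c := γ) (by omega)
  have hb : (b : ℕ) = k := by have := e.2.1; have := e.2.2.1; omega
  have hb' : b' = b := by ext; have := f.1; have := f.2.1; omega
  subst hb'
  have up : (k : ℕ) ≤ w b' := by
    rcases e.partner h with ⟨c, f', hbl⟩ | ⟨a', b'', e', -, hne, -⟩
    · have := h.le_apply_of_blocked hα hb f' hbl
      have := h.val_cases c
      have := f'.2.2.1
      omega
    · exact absurd (Fin.ext (by have := e'.2.1; have := e'.2.2.1; omega)) hne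
  rcases f.partner h with ⟨a, e', hbl⟩ | ⟨b'', c', e', hne, -⟩
  · have va := h.val_cases a
    have vb := h.val_cases b'
    have e1 := e'.1
    have h1 := hbl.2
    unfold PosBox at h1
    push Not at h1
    obtain ⟨p, q, h1, h2, h3, h4, h5⟩ := h1
    have hp : p = k + 1 := by omega
    subst hp
    have h6 : dd x w (k + 1) (x a + 1) ≤ dd x w (k + 1) q := by
      refine h.mono_upQ h3 (by omega) fun r hr1 hr2 => ?_
      have := h.val_cases r
      omega
    have h7 : 1 ≤ dd x w b' (x a + 1) := e'.one_le (by omega) (by omega) (by omega) (by omega)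
    have h8 := h.step b' (x a + 1)
    rw [if_pos (by omega), if_pos (by omega)] at h8
    rw [hb] at h7 h8
    omega
  · exact absurd (Fin.ext (by have := e'.1; have := e'.2.1; omega)) hne

lemma dd_top_le (h : Cfg n k l m x w) : dd x w k (k + l) ≤ 0 := by
  by_contra hD
  have hl := h.two_le_l
  have hn := h.sum
  have hk := h.hk
  have hm := h.hm
  obtain ⟨α, hα⟩ : ∃ α : Fin n, (α : ℕ) = k - 1 := ⟨⟨k - 1, by omega⟩, rfl⟩
  obtain ⟨b₁, hb₁⟩ : ∃ b : Fin n, (b : ℕ) = k := ⟨⟨k, by omega⟩, rfl⟩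
  obtain ⟨b₂, hb₂⟩ : ∃ b : Fin n, (b : ℕ) = k + 1 := ⟨⟨k + 1, by omega⟩, rfl⟩
  obtain ⟨γ, hγ⟩ : ∃ γ : Fin n, (γ : ℕ) = n - 1 := ⟨⟨n - 1, by omega⟩, rfl⟩
  have vα := h.val_cases α
  have vb₁ := h.val_cases b₁
  have vb₂ := h.val_cases b₂
  have vγ := h.val_cases γ
  have e : EA k l x w α b₁ := by
    have h1 := h.freeA (a := α) (by omega)
    have h2 : dd x w k (k + l) ≤ dd x w k (x b₁) :=
      h.mono_downQ (by omega) (by omega) fun r hr1 hr2 => by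
        have := h.val_cases r
        omega
    have e1 : (α : ℕ) + 1 = k := by omega
    rw [e1] at h1
    refine h.EA_of_corners (by omega) (by omega) (by omega) ?_ ?_ ?_ ?_ <;>
      simp only [e1, hb₁] <;> omega
  have f : EC k l x w b₁ γ := by
    refine ⟨by omega, by omega, by omega, Fin.lt_def.2 (by omega), Fin.lt_def.2 (by omega), ?_⟩
    intro p q h1 h2 h3 h4
    have hq : q = k + l := by omega
    subst hq
    by_cases hp : p ≤ k + l
    · have : dd x w k (k + l) ≤ dd x w p (k + l) :=
        h.mono_up (by omega) (by omega) fun r hr1 hr2 => by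
          have := h.val_cases r
          omega
      omega
    · have h5 := h.freeC (c := γ) (by omega)
      have : dd x w γ (k + l) ≤ dd x w p (k + l) :=
        h.mono_down (by omega) (by omega) fun r hr1 hr2 => by
          have := h.val_cases r
          omega
      have e1 : (x γ : ℕ) = k + l := by omega
      rw [e1] at h5
      omega
  have hnb : ¬ Blocked x w α b₁ γ := by
    intro hbl
    refine hbl.1 fun p q h1 h2 h3 h4 => ?_
    have hp : p = k := by omega
    have hq : q = k + l := by omega
    subst hp hq
    omega
  obtain ⟨c, f', hbl⟩ : ∃ c, EC k l x w b₁ c ∧ Blocked x w α b₁ c := by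
    rcases e.partner h with h1 | ⟨a', b', e', ha', hb', hcl⟩
    · exact h1
    · exact absurd (e.clash_blocked h e' ha' hb' hcl f) hnb
  have hup : k + l ≤ (w b₁ : ℕ) := by
    have h1 := h.le_apply_of_blocked hα hb₁ f' hbl
    have h2 := h.val_cases c
    have h3 := f'.2.2.1
    omega
  obtain ⟨a, e', hbl'⟩ : ∃ a, EA k l x w a b₁ ∧ Blocked x w a b₁ γ := by
    rcases f.partner h with h1 | ⟨b', c', e', hb', hc', hcl⟩
    · exact h1
    · exact absurd (f.clash_blocked h e' hb' hc' hcl e) hnb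
  have ha := e'.1
  have va := h.val_cases a
  have h1 : dd x w (a + 1) (k + l) ≤ 0 := by
    have h1 := hbl'.1
    unfold PosBox at h1
    push Not at h1
    obtain ⟨p, q, h1, h2, h3, h4, h5⟩ := h1
    have hq : q = k + l := by omega
    subst hq
    have : dd x w (a + 1) (k + l) ≤ dd x w p (k + l) :=
      h.mono_up (by omega) (by omega) fun r hr1 hr2 => by
        have := h.val_cases r
        omega
    omega
  have haα : a ≠ α := by
    rintro rfl
    have e1 : (a : ℕ) + 1 = k := by omega
    rw [e1] at h1
    omega
  have haα' : (a : ℕ) < k - 1 := by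
    have : (a : ℕ) ≠ α := fun h' => haα (Fin.ext h')
    omega
  obtain ⟨β, hβ⟩ : ∃ b : Fin n, (b : ℕ) = k + l - 1 := ⟨⟨k + l - 1, by omega⟩, rfl⟩
  have vβ := h.val_cases β
  have e1 : (β : ℕ) + 1 = k + l := by omega
  have h2 : 1 ≤ dd x w (a + 1) β := e'.one_le (by omega) (by omega) (by omega) (by omega)
  have h3 := h.stepQ (a + 1) β
  have h4 := h.stepQ k β
  rw [e1] at h3 h4
  rw [if_pos (c := (a : ℕ) + 1 ≤ x β) (by omega)] at h3
  rw [if_pos (c := k ≤ (x β : ℕ)) (by omega)] at h4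
  have h5 : (w⁻¹ β : ℕ) ≤ a := by
    by_contra hcon
    rw [if_pos (by omega)] at h3
    omega
  rw [if_neg (by omega)] at h4
  have h6 : 1 ≤ dd x w (k + 1) β := by
    have h6 := h.step b₁ β
    rw [hb₁] at h6
    split_ifs at h6 <;> omega
  have h7 : 1 ≤ dd x w k (x a + 1) := e'.one_le (by omega) (by omega) (by omega) (by omega)
  have h8 : 1 ≤ dd x w (k + 1) (x a + 1) := by
    have h8 := h.step b₁ (x a + 1)
    rw [hb₁, if_pos (by omega)] at h8
    split_ifs at h8 <;> omega
  have e₂ : EA k l x w a b₂ := by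
    refine h.EA_of_corners ha (by omega) (by omega) (h.freeA ha) ?_ (by rwa [hb₂]) ?_
    · refine h2.trans (h.mono_downQ (by omega) (by omega) fun r hr1 hr2 => ?_)
      have := h.val_cases r
      omega
    · rw [hb₂]
      refine h6.trans (h.mono_downQ (by omega) (by omega) fun r hr1 hr2 => ?_)
      have := h.val_cases r
      omega
  have hbb : b₂ ≠ b₁ := fun h' => by
    rw [h'] at hb₂
    omega
  exact hnb (e.clash_blocked h e₂ haα hbb (e.blocked_clash h e₂ haα hbb f' hbl) f)

lemma dd_top (h : Cfg n k l m x w) : dd x w k (k + l) = 0 :=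
  le_antisymm h.dd_top_le (h.nonneg _ _)

lemma dd_right (h : Cfg n k l m x w) : dd x w (k + l) k = 0 := by
  rw [← h.dd_inv']
  exact h.inv.dd_top

lemma blocked (h : Cfg n k l m x w) {a b c : Fin n} (e : EA k l x w a b) (f : EC k l x w b c) :
    Blocked x w a b c := by
  have va := h.val_cases a
  have vb := h.val_cases b
  have vc := h.val_cases c
  have e1 := e.1
  have f1 := f.1
  have f2 := f.2.1
  have f3 := f.2.2.1
  have hn := h.sum
  constructor
  · intro hp
    have := hp k (k + l) (by omega) (by omega) (by omega) (by omega)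
    rw [h.dd_top] at this
    omega
  · intro hp
    have := hp (k + l) k (by omega) (by omega) (by omega) (by omega)
    rw [h.dd_right] at this
    omega

end Cfg

namespace Cfg

variable {n k l m : ℕ} {x w : Equiv.Perm (Fin n)}

lemma exists_EA_of_mid (h : Cfg n k l m x w) {b : Fin n} (hb : k ≤ (b : ℕ))
    (hb' : (b : ℕ) < k + l) : ∃ a, EA k l x w a b := by
  by_contra hcon
  have hn := h.sum
  have hk := h.hk
  obtain ⟨c, f⟩ := (h.exists_EA_or_EC hb hb').resolve_left hcon
  rcases f.partner h with ⟨a, e, -⟩ | ⟨b', c', f', hbb, hcc, hcl⟩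
  · exact hcon ⟨a, e⟩
  have only : ∀ a b'', EA k l x w a b'' → b'' = b' := fun a b'' e => by
    rcases f.clash_mem h f' hbb hcc hcl e with rfl | h'
    · exact absurd ⟨a, e⟩ hcon
    · exact h'
  obtain ⟨α, hα⟩ : ∃ α : Fin n, (α : ℕ) = k - 1 := ⟨⟨k - 1, by omega⟩, rfl⟩
  obtain ⟨o, ho⟩ : ∃ o : Fin n, (o : ℕ) = 0 := ⟨⟨0, by omega⟩, rfl⟩
  obtain ⟨b₁, e₁⟩ := h.exists_EA (a := α) (by omega)
  obtain ⟨b₂, e₂⟩ := h.exists_EA (a := o) (by omega)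
  obtain rfl := only _ _ e₁
  obtain rfl := only _ _ e₂
  have vα := h.val_cases α
  have vo := h.val_cases o
  have vb := h.val_cases b₂
  have vc := h.val_cases c'
  have f1 := f'.1
  have f2 := f'.2.1
  have f3 := f'.2.2.1
  have h1 : 1 ≤ dd x w b₂ (x b₂) := e₁.one_le (by omega) le_rfl (by omega) le_rfl
  have h2 : 1 ≤ dd x w (b₂ + 1) (x b₂ + 1) :=
    f'.one_le (by omega) (by omega) (by omega) (by omega)
  have h3 := h.step b₂ (x b₂)
  have h4 := h.step b₂ (x b₂ + 1)
  rw [if_pos (c := (x b₂ : ℕ) ≤ x b₂) le_rfl] at h3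
  rw [if_neg (c := (x b₂ : ℕ) + 1 ≤ x b₂) (by omega)] at h4
  by_cases hw : (x b₂ : ℕ) + 1 ≤ w b₂
  · rw [if_pos (by omega)] at h3
    have h5 : 1 ≤ dd x w (b₂ + 1) (x b₂) := by omega
    by_cases hlast : (b₂ : ℕ) + 1 = k + l
    · have e0 : (x b₂ : ℕ) = k := by omega
      rw [hlast, e0, h.dd_right] at h5
      omega
    obtain ⟨b₃, hb₃⟩ : ∃ b : Fin n, (b : ℕ) = b₂ + 1 := ⟨⟨b₂ + 1, by omega⟩, rfl⟩
    have vb₃ := h.val_cases b₃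
    have h6 : ∀ q : ℕ, k ≤ q → q ≤ x b₂ → 1 ≤ dd x w b₃ q := fun q hq hq' => by
      rw [hb₃]
      refine h5.trans (h.mono_downQ hq' (by omega) fun r hr1 hr2 => ?_)
      have := h.val_cases r
      omega
    have e3 : EA k l x w o b₃ :=
      h.EA_of_corners (by omega) (by omega) (by omega) (h.freeA (by omega))
        (e₂.one_le (by omega) (by omega) (by omega) (by omega)) (h6 _ (by omega) (by omega))
        (h6 _ (by omega) (by omega))
    have := congrArg Fin.val (only _ _ e3)
    omega
  · rw [if_neg hw] at h4
    have h5 : 1 ≤ dd x w b₂ (x b₂ + 1) := by omega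
    by_cases hfirst : (b₂ : ℕ) = k
    · have e0 : (x b₂ : ℕ) + 1 = k + l := by omega
      rw [hfirst, e0, h.dd_top] at h5
      omega
    obtain ⟨b₃, hb₃⟩ : ∃ b : Fin n, (b : ℕ) = b₂ - 1 := ⟨⟨b₂ - 1, by omega⟩, rfl⟩
    have vb₃ := h.val_cases b₃
    have e0 : (x b₃ : ℕ) = x b₂ + 1 := by omega
    have h6 : ∀ p : ℕ, k ≤ p → p ≤ b₂ → 1 ≤ dd x w p (x b₃) := fun q hq hq' => by
      rw [e0]
      refine h5.trans (h.mono_down hq' (by omega) fun r hr1 hr2 => ?_)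
      have := h.val_cases r
      omega
    have e3 : EA k l x w α b₃ :=
      h.EA_of_corners (by omega) (by omega) (by omega) (h.freeA (by omega))
        (h6 _ (by omega) (by omega))
        (e₁.one_le (by omega) (by omega) (by omega) (by omega))
        (h6 _ (by omega) (by omega))
    have := congrArg Fin.val (only _ _ e3)
    omega

lemma exists_EC_of_mid (h : Cfg n k l m x w) {b : Fin n} (hb : k ≤ (b : ℕ))
    (hb' : (b : ℕ) < k + l) : ∃ c, EC k l x w b c := by
  have hn := h.sum
  obtain ⟨c, e⟩ := h.rev.exists_EA_of_mid (b := Fin.rev b) (by rw [Fin.val_rev]; omega)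
    (by rw [Fin.val_rev]; omega)
  obtain ⟨c, rfl⟩ := Fin.rev_surjective c
  exact ⟨c, (h.EA_rev b c).1 e⟩

lemma k_eq_one (h : Cfg n k l m x w) (hl : 3 ≤ l) : k = 1 := by
  by_contra hk1
  have hn := h.sum
  have hk := h.hk
  have no : ∀ a b a' b', EA k l x w a b → EA k l x w a' b' → a' ≠ a → b' ≠ b → False := by
    intro a b a' b' e e' ha hb
    obtain ⟨c, f⟩ := h.exists_EC_of_mid e.2.1 e.2.2.1
    have hcl := e.blocked_clash h e' ha hb f (h.blocked e f)
    have key : ∀ i, i < 3 → k + i = b ∨ k + i = b' := by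
      intro i hi
      obtain ⟨c', f'⟩ := h.exists_EC_of_mid (b := ⟨k + i, by omega⟩) (Nat.le_add_right k i)
        (by simp only; omega)
      rcases e.clash_mem h e' ha hb hcl f' with h' | h'
      · exact Or.inl (congrArg Fin.val h')
      · exact Or.inr (congrArg Fin.val h')
    have h0 := key 0 (by omega)
    have h1 := key 1 (by omega)
    have h2 := key 2 (by omega)
    omega
  obtain ⟨a₀, ha₀⟩ : ∃ a : Fin n, (a : ℕ) = 0 := ⟨⟨0, by omega⟩, rfl⟩
  obtain ⟨a₁, ha₁⟩ : ∃ a : Fin n, (a : ℕ) = 1 := ⟨⟨1, by omega⟩, rfl⟩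
  have ha : a₁ ≠ a₀ := fun h' => by rw [h'] at ha₁; omega
  obtain ⟨b, e₀⟩ := h.exists_EA (a := a₀) (by omega)
  obtain ⟨b', e₁⟩ := h.exists_EA (a := a₁) (by omega)
  obtain rfl : b' = b := by
    by_contra hb
    exact no _ _ _ _ e₀ e₁ ha hb
  obtain ⟨b'', hb, hb1, hb2⟩ : ∃ b'' : Fin n, b'' ≠ b' ∧ k ≤ (b'' : ℕ) ∧ (b'' : ℕ) < k + l := by
    by_cases hb : (b' : ℕ) = k
    · exact ⟨⟨k + 1, by omega⟩, fun h' => by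
        have := congrArg Fin.val h'
        simp only at this
        omega, by simp only; omega, by simp only; omega⟩
    · exact ⟨⟨k, by omega⟩, fun h' => hb (congrArg Fin.val h').symm, le_rfl, by simp only; omega⟩
  obtain ⟨a, e⟩ := h.exists_EA_of_mid hb1 hb2
  by_cases haa : a = a₀
  · exact no _ _ _ _ e₁ e (fun h' => ha (h'.symm.trans haa)) hb
  · exact no _ _ _ _ e₀ e haa hb

lemma l_eq_two (h : Cfg n k l m x w) (hkm : 1 < k ∨ 1 < m) : l = 2 := by
  by_contra hl
  have h2 := h.two_le_l
  have h3 := h.k_eq_one (by omega)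
  have h4 := h.rev.k_eq_one (by omega)
  omega

lemma apply_left (h : Cfg n k 2 m x w) :
    (∀ i : Fin n, (i : ℕ) < k → (w i : ℕ) = if (i : ℕ) = 0 then k + 1 else k - i) ∧
      ∀ i : Fin n, (i : ℕ) = k → k + 2 ≤ (w i : ℕ) := by
  have hn := h.sum
  have hk := h.hk
  have hm := h.hm
  obtain ⟨b₀, hb₀⟩ : ∃ b : Fin n, (b : ℕ) = k := ⟨⟨k, by omega⟩, rfl⟩
  obtain ⟨b₁, hb₁⟩ : ∃ b : Fin n, (b : ℕ) = k + 1 := ⟨⟨k + 1, by omega⟩, rfl⟩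
  have vb₀ := h.val_cases b₀
  have vb₁ := h.val_cases b₁
  have ub : ∀ i : Fin n, (i : ℕ) < k → (w i : ℕ) ≤ k + 1 := by
    intro i hi
    by_contra hcon
    have h1 := h.step i (k + 2)
    have vi := h.val_cases i
    rw [if_pos (by omega), if_neg (by omega)] at h1
    have h2 : dd x w (i + 1) (k + 2) ≤ dd x w k (k + 2) :=
      h.mono_up (by omega) (by omega) fun r hr1 hr2 => by
        have := h.val_cases r
        omega
    rw [h.dd_top] at h2
    have := h.nonneg i (k + 2)
    omega
  have ne : ∀ i : Fin n, (i : ℕ) < k → (w i : ℕ) ≠ k := by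
    intro i hi hwi
    obtain ⟨c, f⟩ := h.exists_EC_of_mid (b := b₁) (by omega) (by omega)
    have f3 := f.2.2.1
    have vc := h.val_cases c
    have h1 : 1 ≤ dd x w (k + 2) (k + 1) :=
      f.one_le (by omega) (by omega) (by omega) (by omega)
    have h2 := h.stepQ (k + 2) b₀
    rw [hb₀, h.dd_right, if_neg (c := k + 2 ≤ (x b₀ : ℕ)) (by omega)] at h2
    have h3 : w⁻¹ b₀ = i := by
      rw [Equiv.Perm.inv_eq_iff_eq]
      exact Fin.ext (by omega)
    rw [h3, if_neg (by omega)] at h2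
    omega
  have lb : ∀ i : Fin n, (i : ℕ) < k → k - (i : ℕ) ≤ (w i : ℕ) := by
    intro i hi
    by_contra hcon
    have vi := h.val_cases i
    have h1 := h.freeA hi
    have h2 := h.step i (x i + 1)
    rw [if_neg (by omega), if_neg (by omega)] at h2
    have h3 : dd x w i (x i + 1) ≤ dd x w 0 (x i + 1) :=
      h.mono_down (by omega) (by omega) fun r hr1 hr2 => by
        have := h.val_cases r
        omega
    rw [h.dd_zero_left] at h3
    omega
  obtain ⟨o, ho⟩ : ∃ o : Fin n, (o : ℕ) = 0 := ⟨⟨0, by omega⟩, rfl⟩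
  have hw0 : (w o : ℕ) = k + 1 := by
    have h1 := ub o (by omega)
    have h2 := lb o (by omega)
    have h3 := ne o (by omega)
    omega
  refine ⟨fun i hi => ?_, fun i hi => ?_⟩
  · induction hN : (i : ℕ) using Nat.strong_induction_on generalizing i with
    | _ N ih =>
      subst hN
      split_ifs with h0
      · obtain rfl : i = o := Fin.ext (by omega)
        exact hw0
      · have h1 := ub i hi
        have h2 := lb i hi
        have h3 := ne i hi
        by_contra hcon
        have inj : ∀ j : Fin n, (j : ℕ) < i → (w j : ℕ) ≠ w i := fun j hj h' => by
          have := congrArg Fin.val (w.injective (Fin.ext h'))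
          omega
        have h4 := inj o (by omega)
        have h5 := inj ⟨k - w i, by omega⟩ (by simp only; omega)
        rw [ih (k - w i) (by omega) ⟨k - w i, by omega⟩ (by simp only; omega) rfl,
          if_neg (by omega)] at h5
        omega
  · obtain rfl : i = b₀ := Fin.ext (by omega)
    obtain ⟨c, f⟩ := h.exists_EC_of_mid (b := i) (by omega) (by omega)
    have f3 := f.2.2.1
    have vc := h.val_cases c
    have h1 : 1 ≤ dd x w (i + 1) (k + 2) :=
      f.one_le (by omega) (by omega) (by omega) (by omega)
    by_contra hcon
    have h2 := h.step i (k + 2)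
    rw [if_neg hcon, if_neg (by omega)] at h2
    rw [hi] at h1 h2
    rw [h.dd_top] at h2
    omega

lemma apply_of_l_eq_two (h : Cfg n k 2 m x w) (i : Fin n) : (w i : ℕ) = wklmVal k 2 m i := by
  have hn := h.sum
  have hk := h.hk
  have hm := h.hm
  obtain ⟨l1, l2⟩ := h.apply_left
  obtain ⟨r1, r2⟩ := h.rev.apply_left
  have r1' : ∀ j : Fin n, k + 2 ≤ (j : ℕ) →
      (w j : ℕ) = if (j : ℕ) = n - 1 then k else 2 * k + m + 2 - j := by
    intro j hj
    have h1 := r1 (Fin.rev j) (by rw [Fin.val_rev]; omega)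
    rw [val_revConj_rev, Fin.val_rev] at h1
    have := (w j).2
    split_ifs at h1 ⊢ <;> omega
  have r2' : ∀ j : Fin n, (j : ℕ) = k + 1 → (w j : ℕ) < k := by
    intro j hj
    have h1 := r2 (Fin.rev j) (by rw [Fin.val_rev]; omega)
    rw [val_revConj_rev] at h1
    omega
  have inj : ∀ j : Fin n, (j : ℕ) ≠ i → (w j : ℕ) ≠ w i := fun j hj h' =>
    hj (congrArg Fin.val (w.injective (Fin.ext h')))
  have hwi := (w i).2
  unfold wklmVal
  by_cases c1 : (i : ℕ) < k
  · rw [l1 i c1]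
    split_ifs <;> omega
  by_cases c2 : k + 2 ≤ (i : ℕ)
  · rw [r1' i c2]
    split_ifs <;> omega
  by_cases c3 : (i : ℕ) = k
  · rw [if_neg (by omega), if_neg (by omega), if_pos c3]
    have h1 := l2 i c3
    by_contra hcon
    have h2 := inj ⟨2 * k + m + 2 - w i, by omega⟩ (by simp only; omega)
    rw [r1' ⟨2 * k + m + 2 - w i, by omega⟩ (by simp only; omega)] at h2
    simp only at h2
    split_ifs at h2 <;> omega
  · rw [if_neg (by omega), if_neg (by omega), if_neg c3, if_neg (by omega), if_pos (by omega)]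
    have h1 := r2' i (by omega)
    by_contra hcon
    have h2 := inj ⟨k - w i, by omega⟩ (by simp only; omega)
    rw [l1 ⟨k - w i, by omega⟩ (by simp only; omega)] at h2
    simp only at h2
    split_ifs at h2 <;> omega

end Cfg

namespace Cfg

variable {n l : ℕ} {x w : Equiv.Perm (Fin n)}

lemma edge_left (h : Cfg n 1 l 1 x w) {o b : Fin n} (ho : (o : ℕ) = 0) (hb : 1 ≤ (b : ℕ))
    (hb' : (b : ℕ) < l + 1) : EA 1 l x w o b := by
  obtain ⟨a, e⟩ := h.exists_EA_of_mid hb (by omega)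
  obtain rfl : a = o := Fin.ext (by have := e.1; omega)
  exact e

lemma edge_right (h : Cfg n 1 l 1 x w) {b c : Fin n} (hc : (c : ℕ) = l + 1) (hb : 1 ≤ (b : ℕ))
    (hb' : (b : ℕ) < l + 1) : EC 1 l x w b c := by
  have hn := h.sum
  obtain ⟨c', f⟩ := h.exists_EC_of_mid hb (by omega)
  obtain rfl : c' = c := Fin.ext (by have := f.2.2.1; omega)
  exact f

lemma apply_first (h : Cfg n 1 l 1 x w) {o : Fin n} (ho : (o : ℕ) = 0) : (w o : ℕ) = l := by
  have hn := h.sum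
  have hl := h.two_le_l
  obtain ⟨b, hb⟩ : ∃ b : Fin n, (b : ℕ) = 1 := ⟨⟨1, by omega⟩, rfl⟩
  have e := h.edge_left ho (b := b) (by omega) (by omega)
  have vo := h.val_cases o
  have vb := h.val_cases b
  have h1 : 1 ≤ dd x w 1 l := e.one_le (by omega) (by omega) (by omega) (by omega)
  have h2 := h.dd_top
  have h3 := h.step o l
  have h4 := h.step o (1 + l)
  rw [ho, h.dd_zero_left, if_neg (c := _ ≤ (x o : ℕ)) (by omega), zero_add] at h3 h4
  rw [h2] at h4
  rw [h3] at h1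
  split_ifs at h1 h4 <;> omega

lemma apply_second (h : Cfg n 1 l 1 x w) {i : Fin n} (hi : (i : ℕ) = 1) : (w i : ℕ) = l + 1 := by
  have hn := h.sum
  obtain ⟨c, hc⟩ : ∃ c : Fin n, (c : ℕ) = l + 1 := ⟨⟨l + 1, by omega⟩, rfl⟩
  have h1 := h.inv.rev.apply_first (o := Fin.rev c) (by rw [Fin.val_rev]; omega)
  rw [val_revConj_rev] at h1
  have h2 : w⁻¹ c = i := Fin.ext (by omega)
  rw [Equiv.Perm.inv_eq_iff_eq] at h2
  rw [← h2, hc]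

lemma apply_last (h : Cfg n 1 l 1 x w) {i : Fin n} (hi : (i : ℕ) = l + 1) : (w i : ℕ) = 1 := by
  have hn := h.sum
  have h1 := h.rev.apply_first (o := Fin.rev i) (by rw [Fin.val_rev]; omega)
  rw [val_revConj_rev] at h1
  omega

lemma apply_penult (h : Cfg n 1 l 1 x w) {i : Fin n} (hi : (i : ℕ) = l) : (w i : ℕ) = 0 := by
  have hn := h.sum
  obtain ⟨o, ho⟩ : ∃ o : Fin n, (o : ℕ) = 0 := ⟨⟨0, by omega⟩, rfl⟩
  have h1 := h.inv.apply_first ho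
  have h2 : w⁻¹ o = i := Fin.ext (by omega)
  rw [Equiv.Perm.inv_eq_iff_eq] at h2
  rw [← h2, ho]

/-- A lower bound for the length of `w`, by smoothness above the first covering edge. -/
lemma le_invLen (h : Cfg n 1 l 1 x w) : invLen x + 2 * l ≤ invLen w + 1 := by
  have hn := h.sum
  have hl := h.two_le_l
  obtain ⟨o, ho⟩ : ∃ o : Fin n, (o : ℕ) = 0 := ⟨⟨0, by omega⟩, rfl⟩
  obtain ⟨s, hs⟩ : ∃ b : Fin n, (b : ℕ) = 1 := ⟨⟨1, by omega⟩, rfl⟩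
  obtain ⟨c, hc⟩ : ∃ c : Fin n, (c : ℕ) = l + 1 := ⟨⟨l + 1, by omega⟩, rfl⟩
  have ne : ∀ {u v : Fin n}, (u : ℕ) ≠ v → u ≠ v := fun h h' => h (congrArg Fin.val h')
  have e := h.edge_left ho (b := s) (by omega) (by omega)
  have hu := e.2.2.2
  have hsm := h.smooth hu
  have h1 := invLen_mul_swap_of_noMid x hu.1 hu.2.1
    (h.noMidAB (by omega) (by omega) (by omega))
  set mid : Finset (Fin n) := ((Finset.univ.erase o).erase s).erase c with hmid
  have hcard : mid.card + 1 = l := by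
    rw [hmid, Finset.card_erase_of_mem, Finset.card_erase_of_mem, Finset.card_erase_of_mem,
      Finset.card_univ, Fintype.card_fin]
    · omega
    · simp
    · simp [ne (u := s) (v := o) (by omega)]
    · simp [ne (u := c) (v := o) (by omega), ne (u := c) (v := s) (by omega)]
  have hmem : ∀ b ∈ mid, 2 ≤ (b : ℕ) ∧ (b : ℕ) < l + 1 := by
    intro b hb
    simp only [hmid, Finset.mem_erase, Finset.mem_univ, and_true, ne_eq, Fin.ext_iff] at hb
    omega
  have vo := h.val_cases o
  have vs := h.val_cases s
  have vc := h.val_cases c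
  have yo : ∀ b : Fin n, 2 ≤ (b : ℕ) → (x * Equiv.swap o s) b = x b := fun b hb => by
    rw [Equiv.Perm.mul_apply,
      Equiv.swap_apply_of_ne_of_ne (ne (by omega)) (ne (by omega))]
  have ys : (x * Equiv.swap o s) s = x o := by simp
  have up₁ : ∀ b ∈ mid, Up (x * Equiv.swap o s) w s b := by
    intro b hb
    have hb' := hmem b hb
    have f := (h.edge_left ho (b := b) (by omega) (by omega)).2.2.2
    refine ⟨Fin.lt_def.2 (by omega), ?_, ?_⟩
    · rw [yo b hb'.1, ys]
      exact f.2.1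
    · rw [yo b hb'.1, ys, posBox_mul_swap_of_disjoint x w hu.1 hu.2.1 (Or.inr (Or.inl le_rfl))]
      exact fun p q h1 h2 => f.2.2 p q (by omega) h2
  have up₂ : ∀ b ∈ mid, Up (x * Equiv.swap o s) w b c := by
    intro b hb
    have hb' := hmem b hb
    have f := (h.edge_right hc (b := b) (by omega) (by omega)).2.2.2
    refine ⟨f.1, ?_, ?_⟩
    · rw [yo b hb'.1, yo c (by omega)]
      exact f.2.1
    · rw [yo b hb'.1, yo c (by omega), posBox_mul_swap_of_disjoint x w hu.1 hu.2.1
        (Or.inr (Or.inl (by omega)))]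
      exact f.2.2
  have hle : 2 * mid.card ≤ (R (x * Equiv.swap o s) w).ncard := by
    rw [ncard_R hsm.1]
    have hd : Disjoint (mid.image fun b => (s, b)) (mid.image fun b => (b, c)) := by
      rw [Finset.disjoint_left]
      intro p hp hp'
      rw [Finset.mem_image] at hp hp'
      obtain ⟨b, hb, rfl⟩ := hp
      obtain ⟨b', hb', h'⟩ := hp'
      have := (hmem b' hb').1
      rw [(Prod.mk.inj h').1] at this
      omega
    have hi₁ : (mid.image fun b => (s, b)).card = mid.card :=
      Finset.card_image_of_injective _ fun b b' h' => (Prod.mk.inj h').2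
    have hi₂ : (mid.image fun b => (b, c)).card = mid.card :=
      Finset.card_image_of_injective _ fun b b' h' => (Prod.mk.inj h').1
    have := Finset.card_union_of_disjoint hd
    rw [hi₁, hi₂] at this
    rw [two_mul, ← this]
    refine Finset.card_le_card fun p hp => ?_
    rw [Finset.mem_filter]
    refine ⟨Finset.mem_univ _, ?_⟩
    rw [Finset.mem_union, Finset.mem_image, Finset.mem_image] at hp
    rcases hp with ⟨b, hb, rfl⟩ | ⟨b, hb, rfl⟩
    · exact up₁ b hb
    · exact up₂ b hb
  have := hsm.2
  omega

/-- Between its extreme entries `w` is decreasing. -/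
lemma apply_lt_of_lt (h : Cfg n 1 l 1 x w) {i j : Fin n} (hi : 2 ≤ (i : ℕ)) (hij : i < j)
    (hj : (j : ℕ) < l) : w j < w i := by
  by_contra hcon
  have hn := h.sum
  have hij' := Fin.lt_def.1 hij
  have hle := h.le_invLen
  obtain ⟨o, ho⟩ : ∃ o : Fin n, (o : ℕ) = 0 := ⟨⟨0, by omega⟩, rfl⟩
  obtain ⟨s, hs⟩ : ∃ b : Fin n, (b : ℕ) = 1 := ⟨⟨1, by omega⟩, rfl⟩
  obtain ⟨t, ht⟩ : ∃ b : Fin n, (b : ℕ) = l := ⟨⟨l, by omega⟩, rfl⟩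
  obtain ⟨c, hc⟩ : ∃ c : Fin n, (c : ℕ) = l + 1 := ⟨⟨l + 1, by omega⟩, rfl⟩
  have ne : ∀ {u v : Fin n}, (u : ℕ) ≠ v → u ≠ v := fun h h' => h (congrArg Fin.val h')
  set P : Finset (Fin n × Fin n) := Finset.univ.filter fun p => p.1 < p.2 with hP
  have hw : invLen w + 3 ≤ P.card := by
    have h3 : ({(o, s), (t, c), (i, j)} : Finset (Fin n × Fin n)).card = 3 := by
      rw [Finset.card_eq_three]
      refine ⟨_, _, _, ?_, ?_, ?_, rfl⟩ <;>
        · intro h'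
          have := congrArg Fin.val (Prod.mk.inj h').1
          omega
    rw [← h3, invLen, ← Finset.card_union_of_disjoint]
    · refine Finset.card_le_card fun p hp => ?_
      rw [hP, Finset.mem_filter]
      refine ⟨Finset.mem_univ _, ?_⟩
      simp only [Finset.mem_union, Finset.mem_filter, Finset.mem_univ, true_and,
        Finset.mem_insert, Finset.mem_singleton] at hp
      rcases hp with hp | rfl | rfl | rfl
      · exact hp.1
      · exact Fin.lt_def.2 (by simp only; omega)
      · exact Fin.lt_def.2 (by simp only; omega)
      · exact hij
    · rw [Finset.disjoint_left]
      intro p hp hp'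
      rw [Finset.mem_filter] at hp
      have hp2 := Fin.lt_def.1 hp.2.2
      simp only [Finset.mem_insert, Finset.mem_singleton] at hp'
      rcases hp' with rfl | rfl | rfl
      · rw [h.apply_first ho, h.apply_second hs] at hp2
        omega
      · rw [h.apply_last hc, h.apply_penult ht] at hp2
        omega
      · exact hcon hp.2.2
  have hx : P.card ≤ invLen x + (2 * l + 1) := by
    set S : Finset (Fin n) := Finset.univ.erase o with hS
    have c1 : (S.image fun b => (o, b)).card ≤ l + 1 := by
      refine Finset.card_image_le.trans ?_
      rw [hS, Finset.card_erase_of_mem (Finset.mem_univ _), Finset.card_univ, Fintype.card_fin]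
      omega
    have c2 : ((S.erase c).image fun b => (b, c)).card ≤ l := by
      refine Finset.card_image_le.trans ?_
      rw [hS, Finset.card_erase_of_mem, Finset.card_erase_of_mem (Finset.mem_univ _),
        Finset.card_univ, Fintype.card_fin]
      · omega
      · simp [ne (u := c) (v := o) (by omega)]
    have c3 : P.card ≤ ((Finset.univ.filter
        (fun p : Fin n × Fin n => p.1 < p.2 ∧ x p.2 < x p.1)) ∪
          ((S.image fun b => (o, b)) ∪ ((S.erase c).image fun b => (b, c)))).card := by
      refine Finset.card_le_card fun p hp => ?_
      obtain ⟨u, v⟩ := p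
      rw [hP, Finset.mem_filter] at hp
      have huv := Fin.lt_def.1 hp.2
      simp only at huv
      have vu := h.val_cases u
      have vv := h.val_cases v
      simp only [hS, Finset.mem_union, Finset.mem_filter, Finset.mem_univ, true_and,
        Finset.mem_image, Finset.mem_erase, Prod.mk.injEq]
      by_cases c1 : u = o
      · right; left
        exact ⟨v, ⟨ne (by rw [c1] at huv; omega), trivial⟩, c1.symm, rfl⟩
      · have c1' : (u : ℕ) ≠ o := fun h' => c1 (Fin.ext h')
        by_cases c2 : v = c
        · right; right
          exact ⟨u, ⟨ne (by rw [c2] at huv; omega), c1, trivial⟩, rfl, c2.symm⟩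
        · have c2' : (v : ℕ) ≠ c := fun h' => c2 (Fin.ext h')
          left
          exact ⟨hp.2, Fin.lt_def.2 (by omega)⟩
    have c4 := c3.trans (Finset.card_union_le _ _)
    have c5 := Finset.card_union_le (S.image fun b => (o, b)) ((S.erase c).image fun b => (b, c))
    unfold invLen
    omega
  omega

lemma apply_of_k_m_eq_one (h : Cfg n 1 l 1 x w) (i : Fin n) :
    (w i : ℕ) = wklmVal 1 l 1 i := by
  have hn := h.sum
  have hl := h.two_le_l
  obtain ⟨o, ho⟩ : ∃ o : Fin n, (o : ℕ) = 0 := ⟨⟨0, by omega⟩, rfl⟩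
  obtain ⟨s, hs⟩ : ∃ b : Fin n, (b : ℕ) = 1 := ⟨⟨1, by omega⟩, rfl⟩
  obtain ⟨t, ht⟩ : ∃ b : Fin n, (b : ℕ) = l := ⟨⟨l, by omega⟩, rfl⟩
  obtain ⟨c, hc⟩ : ∃ c : Fin n, (c : ℕ) = l + 1 := ⟨⟨l + 1, by omega⟩, rfl⟩
  have range : ∀ j : Fin n, 2 ≤ (j : ℕ) → (j : ℕ) < l → 2 ≤ (w j : ℕ) ∧ (w j : ℕ) < l := by
    intro j hj hj'
    have inj : ∀ u : Fin n, (u : ℕ) ≠ j → (w u : ℕ) ≠ w j := fun u hu h' =>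
      hu (congrArg Fin.val (w.injective (Fin.ext h')))
    have h1 := inj o (by omega)
    have h2 := inj s (by omega)
    have h3 := inj t (by omega)
    have h4 := inj c (by omega)
    rw [h.apply_first ho] at h1
    rw [h.apply_second hs] at h2
    rw [h.apply_penult ht] at h3
    rw [h.apply_last hc] at h4
    omega
  have ub : ∀ d : ℕ, ∀ j : Fin n, (j : ℕ) = 2 + d → (j : ℕ) < l → (w j : ℕ) + d < l := by
    intro d
    induction d with
    | zero => exact fun j hj hj' => (range j (by omega) hj').2
    | succ d ih =>
      intro j hj hj'
      have h1 := ih ⟨2 + d, by omega⟩ rfl (by simp only; omega)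
      have h2 := Fin.lt_def.1 (h.apply_lt_of_lt (i := ⟨2 + d, by omega⟩) (j := j)
        (Nat.le_add_right 2 d) (Fin.lt_def.2 (by simp only; omega)) hj')
      omega
  have lb : ∀ d : ℕ, ∀ j : Fin n, (j : ℕ) + d + 1 = l → 2 ≤ (j : ℕ) → 2 + d ≤ (w j : ℕ) := by
    intro d
    induction d with
    | zero => exact fun j hj hj' => (range j (by omega) (by omega)).1
    | succ d ih =>
      intro j hj hj'
      have h1 := ih ⟨j + 1, by omega⟩ (by simp only; omega) (by simp only; omega)
      have h2 := Fin.lt_def.1 (h.apply_lt_of_lt (i := j) (j := ⟨j + 1, by omega⟩) hj'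
        (Fin.lt_def.2 (by simp only; omega)) (by simp only; omega))
      omega
  have hi := i.2
  unfold wklmVal
  by_cases c1 : (i : ℕ) = 0
  · rw [if_pos c1, h.apply_first c1]
    omega
  by_cases c2 : (i : ℕ) = 1
  · rw [if_neg c1, if_neg (by omega), if_pos c2, h.apply_second c2]
    omega
  by_cases c3 : (i : ℕ) < l
  · have h1 := ub (i - 2) i (by omega) c3
    have h2 := lb (l - 1 - i) i (by omega) (by omega)
    rw [if_neg c1, if_neg (by omega), if_neg c2, if_pos (by omega)]
    omega
  by_cases c4 : (i : ℕ) = l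
  · rw [if_neg c1, if_neg (by omega), if_neg c2, if_neg (by omega), if_pos (by omega),
      h.apply_penult c4]
  · rw [if_neg c1, if_neg (by omega), if_neg c2, if_neg (by omega), if_neg (by omega),
      if_neg (by omega), h.apply_last (by omega)]

end Cfg

/-- If `x` is an MSP for `w` with `Δ(x,w) = {1,…,n}` and `x` consists of exactly
three decreasing sequences `x = [k,…,1, k+l,…,k+1, k+l+m,…,k+l+1]` (with
`k,l,m ≥ 1`, `k + l + m = n`), then `l ≥ 2`; `l = 2` whenever `k > 1` or `m > 1`;
and `w = [k+l, k,…,2, k+l+m, k+l−1,…,k+2, 1, k+l+m−1,…,k+l+1, k+1]`. -/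
theorem msp_three_decreasing {n : ℕ} (x w : Equiv.Perm (Fin n)) (hmsp : MSP x w)
    (hdelta : Delta x w = Set.univ) (k l m : ℕ) (hk : 1 ≤ k) (hl : 1 ≤ l) (hm : 1 ≤ m)
    (hklm : k + l + m = n) (hx : ∀ i : Fin n, (x i : ℕ) = xklmVal k l m (i : ℕ)) :
    2 ≤ l ∧ (1 < k ∨ 1 < m → l = 2) ∧
      ∀ i : Fin n, (w i : ℕ) = wklmVal k l m (i : ℕ) := by
  have h : Cfg n k l m x w := ⟨hmsp, hdelta, hk, hl, hm, hklm, hx⟩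
  refine ⟨h.two_le_l, h.l_eq_two, ?_⟩
  by_cases hkm : 1 < k ∨ 1 < m
  · obtain rfl := h.l_eq_two hkm
    exact h.apply_of_l_eq_two
  · obtain rfl : k = 1 := by omega
    obtain rfl : m = 1 := by omega
    exact h.apply_of_k_m_eq_one

end BSW
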